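/- Let X be a random vector in ℝ^d with a pdf, finite differential entropy h(X), and finite entropy H(⌊X⌋) of its componentwise integer part. Then the excess rate satisfies ℛ_{r,d} ≥ (d/r) · log( Γ(1+d/r)^{r/d} · e / (1 + d/r) ), where Γ is the Gamma function. -/

import Mathlib

open MeasureTheory Filter Set
open scoped ENNReal Topology ProbabilityTheory Pointwise

noncomputable section

/-- `N` is a norm on `ℝ^d`. -/
structure IsNorm {d : ℕ} (N : (Fin d → ℝ) → ℝ) : Prop where
  nonneg : ∀ x, 0 ≤ N x
  eq_zero_iff : ∀ x, N x = 0 ↔ x = 0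
  smul : ∀ (c : ℝ) (x : Fin d → ℝ), N (c • x) = |c| * N x
  triangle : ∀ x y, N (x + y) ≤ N x + N y

/-- Lebesgue volume `V_d` of the unit ball of the norm `N`. -/
def unitBallVol {d : ℕ} (N : (Fin d → ℝ) → ℝ) : ℝ :=
  (volume {x : Fin d → ℝ | N x ≤ 1}).toReal

/-- A (symbol-wise) quantizer: countably many disjoint Borel quantization regions `S i`
covering the space, with reconstruction values `c i`. -/
structure Quantizer (E : Type*) [MeasurableSpace E] where
  S : ℤ → Set E
  c : ℤ → E
  meas : ∀ i, MeasurableSet (S i)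
  disj : Pairwise (Function.onFun Disjoint S)
  cover : ⋃ i, S i = Set.univ

/-- Expected `r`-th power distortion `E[‖X - q(X)‖^r]` of a quantizer, for a source with law `μ`
and norm `N`. -/
def Quantizer.distortion {E : Type*} [MeasurableSpace E] [Sub E] (q : Quantizer E)
    (μ : Measure E) (N : E → ℝ) (r : ℝ) : ℝ≥0∞ :=
  ∑' i, ∫⁻ x in q.S i, ENNReal.ofReal (N (x - q.c i) ^ r) ∂μ

/-- Output entropy `H(q(X)) = -∑ pᵢ log pᵢ` of a quantizer (as an extended nonneg. real). -/
def Quantizer.entropy {E : Type*} [MeasurableSpace E] (q : Quantizer E) (μ : Measure E) : ℝ≥0∞ :=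
  ∑' i, ENNReal.ofReal (Real.negMulLog (μ (q.S i)).toReal)

/-- Output entropy `H(q(X)) = -∑ pᵢ log pᵢ` of a quantizer (as a real number). -/
def Quantizer.entropyR {E : Type*} [MeasurableSpace E] (q : Quantizer E) (μ : Measure E) : ℝ :=
  ∑' i, Real.negMulLog (μ (q.S i)).toReal

open scoped Classical in
/-- Kullback-Leibler divergence between two measures. -/
def klDiv {α : Type*} [MeasurableSpace α] (μ ν : Measure α) : ℝ≥0∞ :=
  if μ ≪ ν ∧ Integrable (fun x => Real.log (μ.rnDeriv ν x).toReal) μ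
  then ENNReal.ofReal (∫ x, Real.log (μ.rnDeriv ν x).toReal ∂μ)
  else ⊤

/-- Mutual information of a joint law `π`, i.e. the KL divergence of `π` from the product of
its marginals. -/
def mutualInfo {α β : Type*} [MeasurableSpace α] [MeasurableSpace β]
    (π : Measure (α × β)) : ℝ≥0∞ :=
  klDiv π ((π.map Prod.fst).prod (π.map Prod.snd))

/-- The rate-distortion function `R(D)`: the infimum of the mutual information `I(X; X̂)` over
all Markov kernels `P_{X̂|X}` with expected `r`-th power distortion at most `D`. -/
def RDfun {E : Type*} [MeasurableSpace E] [Sub E] (μ : Measure E) (N : E → ℝ) (r D : ℝ) :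
    ℝ≥0∞ :=
  ⨅ (κ : ProbabilityTheory.Kernel E E) (_ : ProbabilityTheory.IsMarkovKernel κ)
    (_ : ∫⁻ p, ENNReal.ofReal (N (p.1 - p.2) ^ r) ∂(μ.compProd κ) ≤ ENNReal.ofReal D),
    mutualInfo (μ.compProd κ)

/-- The smallest output entropy `R_{r,d}(D)` of a quantizer with `r`-th power distortion
at most `D`. -/
def RQfun {E : Type*} [MeasurableSpace E] [Sub E] (μ : Measure E) (N : E → ℝ) (r D : ℝ) :
    ℝ≥0∞ :=
  ⨅ (q : Quantizer E) (_ : q.distortion μ N r ≤ ENNReal.ofReal D), q.entropy μ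

/-- The asymptotic excess rate `ℛ = liminf_{D ↓ 0} (R_{r,d}(D) - R(D))`. -/
def excessRate {E : Type*} [MeasurableSpace E] [Sub E] (μ : Measure E) (N : E → ℝ) (r : ℝ) :
    ℝ :=
  Filter.liminf (fun D => (RQfun μ N r D).toReal - (RDfun μ N r D).toReal) (𝓝[>] (0:ℝ))

/-- The upper incomplete Gamma function `Γ(s, a) = ∫_a^∞ ξ^(s-1) e^(-ξ) dξ`. -/
def uGamma (s a : ℝ) : ℝ := ∫ ξ in Set.Ioi a, ξ ^ (s - 1) * Real.exp (-ξ)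

/-- The part of the quantization cell `S i` within distance `ε` of the reconstruction point. -/
def Bcell {E : Type*} [MeasurableSpace E] [Sub E] (q : Quantizer E) (N : E → ℝ) (ε : ℝ)
    (i : ℤ) : Set E :=
  {x | x ∈ q.S i ∧ N (x - q.c i) ≤ ε}

namespace IsNorm

variable {d : ℕ} {N : (Fin d → ℝ) → ℝ}

lemma map_zero (hN : IsNorm N) : N 0 = 0 := (hN.eq_zero_iff 0).2 rfl

lemma neg (hN : IsNorm N) (x : Fin d → ℝ) : N (-x) = N x := by
  simpa using hN.smul (-1) x

lemma sub_comm (hN : IsNorm N) (x y : Fin d → ℝ) : N (x - y) = N (y - x) := by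
  rw [← hN.neg, neg_sub]

lemma sub_le (hN : IsNorm N) (x y : Fin d → ℝ) : N x - N y ≤ N (x - y) := by
  have := hN.triangle (x - y) y
  rw [sub_add_cancel] at this
  linarith

lemma exists_le_mul_norm (hN : IsNorm N) : ∃ C, 0 < C ∧ ∀ x, N x ≤ C * ‖x‖ := by
  refine ⟨1 + ∑ i, N (Pi.single i 1), ?_, fun x => ?_⟩
  · have := Finset.sum_nonneg fun i (_ : i ∈ Finset.univ) => hN.nonneg (Pi.single i 1)
    linarith
  have h : ∀ s : Finset (Fin d), N (∑ i ∈ s, x i • Pi.single i (1 : ℝ)) ≤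
      ∑ i ∈ s, |x i| * N (Pi.single i 1) := by
    intro s
    induction s using Finset.cons_induction with
    | empty => simp [hN.map_zero]
    | cons a s ha ih =>
      rw [Finset.sum_cons, Finset.sum_cons, ← hN.smul]
      exact (hN.triangle _ _).trans (by gcongr)
  have hx : ∑ i, x i • (Pi.single i (1 : ℝ) : Fin d → ℝ) = x := by
    ext j
    simp [Finset.sum_apply, Pi.single_apply]
  have h1 := h Finset.univ
  rw [hx] at h1
  calc N x ≤ ∑ i, |x i| * N (Pi.single i 1) := h1
    _ ≤ ∑ i, ‖x‖ * N (Pi.single i 1) := by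
        gcongr with i
        · exact hN.nonneg _
        · exact norm_le_pi_norm x i
    _ ≤ (1 + ∑ i, N (Pi.single i 1)) * ‖x‖ := by
        rw [← Finset.mul_sum]
        nlinarith [norm_nonneg x]

lemma continuous (hN : IsNorm N) : Continuous N := by
  obtain ⟨C, hC, h⟩ := hN.exists_le_mul_norm
  refine (LipschitzWith.of_dist_le_mul (K := C.toNNReal) fun x y => ?_).continuous
  rw [Real.dist_eq, dist_eq_norm, Real.coe_toNNReal _ hC.le, abs_le]
  have h1 := hN.sub_le x y
  have h2 := hN.sub_le y x
  rw [hN.sub_comm] at h2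
  have := h (x - y)
  constructor <;> linarith

lemma measurable (hN : IsNorm N) : Measurable N := hN.continuous.measurable

lemma rpow_smul (hN : IsNorm N) {r t : ℝ} (ht : 0 ≤ t) (x : Fin d → ℝ) :
    N (t • x) ^ r = t ^ r * N x ^ r := by
  rw [hN.smul, abs_of_nonneg ht, Real.mul_rpow ht (hN.nonneg x)]

lemma rpow_nonneg (hN : IsNorm N) (r : ℝ) (x : Fin d → ℝ) : 0 ≤ N x ^ r :=
  Real.rpow_nonneg (hN.nonneg x) r

lemma continuous_rpow (hN : IsNorm N) {r : ℝ} (hr : 0 < r) : Continuous fun x => N x ^ r :=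
  hN.continuous.rpow_const fun _ => Or.inr hr.le

lemma add_rpow_le (hN : IsNorm N) {r : ℝ} (hr : 0 < r) (x y : Fin d → ℝ) :
    N (x + y) ^ r ≤ 2 ^ r * (N x ^ r + N y ^ r) := by
  have key : ∀ a b : ℝ, 0 ≤ a → 0 ≤ b → a ≤ b → (a + b) ^ r ≤ 2 ^ r * (a ^ r + b ^ r) := by
    intro a b ha hb hab
    calc (a + b) ^ r ≤ (2 * b) ^ r := by gcongr; linarith
      _ = 2 ^ r * b ^ r := Real.mul_rpow zero_le_two hb
      _ ≤ _ := by
        gcongr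
        linarith [Real.rpow_nonneg ha r]
  refine (Real.rpow_le_rpow (hN.nonneg _) (hN.triangle x y) hr.le).trans ?_
  rcases le_total (N x) (N y) with h | h
  · exact key _ _ (hN.nonneg x) (hN.nonneg y) h
  · rw [add_comm (N x), add_comm (N x ^ r)]
    exact key _ _ (hN.nonneg y) (hN.nonneg x) h

/-- The volume of the open unit ball of `N`. -/
def ballVol (N : (Fin d → ℝ) → ℝ) : ℝ := volume.real {x | N x < 1}

lemma volume_lt_one (hN : IsNorm N) {r : ℝ} (hr : 0 < r) :
    volume {x | N x < 1} =
      ENNReal.ofReal ((∫ x, Real.exp (-(N x) ^ r)) / Real.Gamma (1 + d / r)) := by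
  have := MeasureTheory.measure_lt_one_eq_integral_div_gamma (μ := (volume : Measure (Fin d → ℝ)))
    hN.map_zero hN.neg hN.triangle (fun {x} h => (hN.eq_zero_iff x).1 h)
    (fun c x => (hN.smul c x).le) hr
  rw [this]
  simp [add_comm]

lemma volume_lt_one_ne_top (hN : IsNorm N) : volume {x | N x < 1} ≠ ∞ := by
  rw [hN.volume_lt_one one_pos]
  exact ENNReal.ofReal_ne_top

lemma ballVol_pos (hN : IsNorm N) : 0 < ballVol N := by
  refine ENNReal.toReal_pos (IsOpen.measure_pos _ ?_ ⟨0, ?_⟩).ne' hN.volume_lt_one_ne_top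
  · exact isOpen_lt hN.continuous continuous_const
  · simp [hN.map_zero]

lemma gamma_pos (d : ℕ) {r : ℝ} (hr : 0 < r) : 0 < Real.Gamma (1 + d / r) :=
  Real.Gamma_pos_of_pos (by positivity)

lemma integral_exp (hN : IsNorm N) {r : ℝ} (hr : 0 < r) :
    ∫ x, Real.exp (-(N x) ^ r) = ballVol N * Real.Gamma (1 + d / r) := by
  have h : ballVol N = (∫ x, Real.exp (-(N x) ^ r)) / Real.Gamma (1 + d / r) := by
    rw [ballVol, Measure.real, hN.volume_lt_one hr, ENNReal.toReal_ofReal]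
    exact div_nonneg (integral_nonneg fun x => (Real.exp_pos _).le) (gamma_pos d hr).le
  rw [h, div_mul_cancel₀ _ (gamma_pos d hr).ne']

lemma integrable_exp (hN : IsNorm N) {r : ℝ} (hr : 0 < r) :
    Integrable fun x => Real.exp (-(N x) ^ r) := by
  by_contra h
  have := hN.integral_exp hr
  rw [integral_undef h] at this
  exact (mul_pos hN.ballVol_pos (gamma_pos d hr)).ne this

lemma exp_neg_mul_eq (hN : IsNorm N) {r s : ℝ} (hr : 0 < r) (hs : 0 < s) (x : Fin d → ℝ) :
    Real.exp (-(s * N x ^ r)) = Real.exp (-(N (s ^ (1 / r) • x)) ^ r) := by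
  rw [hN.rpow_smul (by positivity), ← Real.rpow_mul hs.le, one_div_mul_cancel hr.ne',
    Real.rpow_one]

lemma integrable_exp_mul (hN : IsNorm N) {r s : ℝ} (hr : 0 < r) (hs : 0 < s) :
    Integrable fun x => Real.exp (-(s * N x ^ r)) := by
  simp_rw [hN.exp_neg_mul_eq hr hs]
  exact (hN.integrable_exp hr).comp_smul (by positivity)

lemma integral_exp_mul (hN : IsNorm N) {r s : ℝ} (hr : 0 < r) (hs : 0 < s) :
    ∫ x, Real.exp (-(s * N x ^ r)) =
      ballVol N * Real.Gamma (1 + d / r) * s ^ (-(d / r) : ℝ) := by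
  simp_rw [hN.exp_neg_mul_eq hr hs]
  rw [Measure.integral_comp_smul volume (fun x => Real.exp (-(N x) ^ r)), hN.integral_exp hr,
    smul_eq_mul, mul_comm, abs_of_pos (by positivity), Module.finrank_fin_fun, ← Real.rpow_natCast,
    ← Real.rpow_mul hs.le, Real.rpow_neg hs.le]
  congr 3
  ring

lemma integrable_rpow_mul_exp (hN : IsNorm N) {r : ℝ} (hr : 0 < r) :
    Integrable fun x => N x ^ r * Real.exp (-(N x) ^ r) := by
  refine ((hN.integrable_exp_mul hr (half_pos one_pos)).const_mul 2).mono' ?_ ?_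
  · exact (((hN.continuous_rpow hr).mul
      (Real.continuous_exp.comp (hN.continuous_rpow hr).neg))).aestronglyMeasurable
  · refine Eventually.of_forall fun x => ?_
    have hu := hN.rpow_nonneg r x
    rw [Real.norm_of_nonneg (by positivity)]
    have h1 := Real.add_one_le_exp (1 / 2 * N x ^ r)
    have h2 : Real.exp (-(N x) ^ r) =
        Real.exp (-(1 / 2 * N x ^ r)) * Real.exp (-(1 / 2 * N x ^ r)) := by
      rw [← Real.exp_add]; ring_nf
    have h3 : Real.exp (1 / 2 * N x ^ r) * Real.exp (-(1 / 2 * N x ^ r)) = 1 := by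
      rw [← Real.exp_add]; simp
    have h4 := Real.exp_pos (-(1 / 2 * N x ^ r))
    rw [h2]
    nlinarith [mul_le_mul_of_nonneg_right h1 h4.le]

lemma integral_rpow_mul_exp (hN : IsNorm N) {r : ℝ} (hr : 0 < r) :
    ∫ x, N x ^ r * Real.exp (-(N x) ^ r) =
      d / r * (ballVol N * Real.Gamma (1 + d / r)) := by
  set F := ballVol N * Real.Gamma (1 + d / r) with hF
  set G := ∫ x, N x ^ r * Real.exp (-(N x) ^ r) with hG
  have hmin : IsLocalMin (fun s : ℝ => F * s ^ (-(d / r) : ℝ) - (1 - s) * G) 1 := by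
    filter_upwards [lt_mem_nhds (zero_lt_one' ℝ)] with s hs
    have h : F + (1 - s) * G ≤ F * s ^ (-(d / r) : ℝ) := by
      rw [hF, ← hN.integral_exp_mul hr hs, ← hN.integral_exp hr, hG, ← integral_const_mul,
        ← integral_add (hN.integrable_exp hr) ((hN.integrable_rpow_mul_exp hr).const_mul _)]
      refine integral_mono ((hN.integrable_exp hr).add
        ((hN.integrable_rpow_mul_exp hr).const_mul _)) (hN.integrable_exp_mul hr hs) fun x => ?_
      have h1 := Real.add_one_le_exp ((1 - s) * N x ^ r)
      have h2 : Real.exp (-(s * N x ^ r)) =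
          Real.exp ((1 - s) * N x ^ r) * Real.exp (-(N x) ^ r) := by
        rw [← Real.exp_add]; ring_nf
      simp only
      rw [h2]
      nlinarith [mul_le_mul_of_nonneg_right h1 (Real.exp_pos (-(N x) ^ r)).le]
    simp only [Real.one_rpow]
    linarith
  have hder : HasDerivAt (fun s : ℝ => F * s ^ (-(d / r) : ℝ) - (1 - s) * G)
      (F * (-(d / r) * (1 : ℝ) ^ (-(d / r) - 1 : ℝ)) - (0 - 1) * G) 1 := by
    refine ((Real.hasDerivAt_rpow_const (Or.inl one_ne_zero)).const_mul F).sub ?_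
    exact ((hasDerivAt_const _ _).sub (hasDerivAt_id _)).mul_const G
  have := hmin.hasDerivAt_eq_zero hder
  rw [Real.one_rpow] at this
  linarith

lemma volume_real_lt (hN : IsNorm N) (c : Fin d → ℝ) {t : ℝ} (ht : 0 < t) :
    volume {x | N (x - c) < t} = ENNReal.ofReal (ballVol N * t ^ d) := by
  have h : {x | N (x - c) < t} = (fun x => x + c) '' (t • {x | N x < 1}) := by
    ext x
    simp only [mem_ofPred_eq, mem_image, Set.mem_smul_set]
    constructor
    · intro hx
      refine ⟨x - c, ⟨t⁻¹ • (x - c), ?_, ?_⟩, by simp⟩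
      · rw [hN.smul, abs_of_pos (by positivity)]
        field_simp
        exact hx
      · rw [smul_smul, mul_inv_cancel₀ ht.ne', one_smul]
    · rintro ⟨_, ⟨y, hy, rfl⟩, rfl⟩
      rw [add_sub_cancel_right, hN.smul, abs_of_pos ht]
      nlinarith
  rw [h, Set.image_add_right, measure_preimage_add_right, Measure.addHaar_smul,
    abs_of_pos (by positivity), Module.finrank_fin_fun, mul_comm, ballVol,
    ENNReal.ofReal_mul measureReal_nonneg, ofReal_measureReal hN.volume_lt_one_ne_top]

lemma volume_real_le (hN : IsNorm N) (hd : 0 < d) (c : Fin d → ℝ) {t : ℝ} (ht : 0 < t) :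
    volume {x | N (x - c) ≤ t} = ENNReal.ofReal (ballVol N * t ^ d) := by
  have : Nonempty (Fin d) := ⟨⟨0, hd⟩⟩
  have h := MeasureTheory.measure_le_eq_lt (μ := (volume : Measure (Fin d → ℝ)))
    hN.map_zero hN.neg hN.triangle (fun {x} h => (hN.eq_zero_iff x).1 h)
    (fun c x => (hN.smul c x).le) t
  have h1 : volume {x | N (x - c) ≤ t} = volume {x | N x ≤ t} := by
    simp_rw [sub_eq_add_neg]
    exact measure_preimage_add_right volume (-c) {x | N x ≤ t}
  have h2 := hN.volume_real_lt 0 ht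
  simp only [sub_zero] at h2
  rw [h1, h, h2]

end IsNorm

lemma mul_log_add_sub_le {a b : ℝ} (ha : 0 ≤ a) (hb : 0 < b) :
    a * Real.log b + a - b ≤ a * Real.log a := by
  rcases ha.eq_or_lt with rfl | ha
  · simp [hb.le]
  have h := Real.log_le_sub_one_of_pos (div_pos hb ha)
  rw [Real.log_div hb.ne' ha.ne'] at h
  have h2 := mul_le_mul_of_nonneg_left h ha.le
  have h3 : a * (b / a - 1) = b - a := by field_simp
  rw [h3] at h2
  linarith

section AdditiveNoise

variable {d : ℕ}

/-- The additive noise channel `x ↦ law of x + Z`, where `Z` has law `ζ`. -/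
def shiftKernel (ζ : Measure (Fin d → ℝ)) : ProbabilityTheory.Kernel (Fin d → ℝ) (Fin d → ℝ) :=
  (ProbabilityTheory.Kernel.id ×ₖ ProbabilityTheory.Kernel.const _ ζ).map fun p => p.1 + p.2

instance (ζ : Measure (Fin d → ℝ)) [IsProbabilityMeasure ζ] :
    ProbabilityTheory.IsMarkovKernel (shiftKernel ζ) :=
  ProbabilityTheory.Kernel.IsMarkovKernel.map _ (by fun_prop)

lemma shiftKernel_apply (ζ : Measure (Fin d → ℝ)) [IsProbabilityMeasure ζ] (x : Fin d → ℝ) :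
    shiftKernel ζ x = ζ.map fun z => x + z := by
  rw [shiftKernel, ProbabilityTheory.Kernel.map_apply _ (by fun_prop),
    ProbabilityTheory.Kernel.prod_apply, ProbabilityTheory.Kernel.id_apply,
    ProbabilityTheory.Kernel.const_apply, Measure.dirac_prod, Measure.map_map (by fun_prop)
    (by fun_prop)]
  rfl

lemma compProd_shiftKernel (μ ζ : Measure (Fin d → ℝ)) [IsProbabilityMeasure μ]
    [IsProbabilityMeasure ζ] :
    μ.compProd (shiftKernel ζ) = (μ.prod ζ).map fun p => (p.1, p.1 + p.2) := by
  ext s hs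
  rw [Measure.compProd_apply hs, Measure.map_apply (by fun_prop) hs,
    Measure.prod_apply (hs.preimage (by fun_prop))]
  refine lintegral_congr fun x => ?_
  rw [shiftKernel_apply, Measure.map_apply (by fun_prop) (hs.preimage (by fun_prop))]
  rfl

variable {μ ζ : Measure (Fin d → ℝ)} {φ : (Fin d → ℝ) → ℝ}

/-- The density of `X + Z`, where `X` has law `μ` and `Z` has density `φ`. -/
def convDensity (μ : Measure (Fin d → ℝ)) (φ : (Fin d → ℝ) → ℝ) (y : Fin d → ℝ) : ℝ≥0∞ :=
  ∫⁻ x, ENNReal.ofReal (φ (y - x)) ∂μ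

lemma measurable_convDensity [IsProbabilityMeasure μ] (hφ : Measurable φ) :
    Measurable (convDensity μ φ) := by
  unfold convDensity
  exact Measurable.lintegral_prod_right' (f := fun p : (Fin d → ℝ) × (Fin d → ℝ) =>
    ENNReal.ofReal (φ (p.1 - p.2))) (by fun_prop)

lemma lintegral_add_left_noise (hφ : Measurable φ)
    (hζ : ζ = volume.withDensity fun x => ENNReal.ofReal (φ x)) {h : (Fin d → ℝ) → ℝ≥0∞}
    (hh : Measurable h) (x : Fin d → ℝ) :
    ∫⁻ z, h (x + z) ∂ζ = ∫⁻ y, ENNReal.ofReal (φ (y - x)) * h y := by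
  rw [hζ, lintegral_withDensity_eq_lintegral_mul _ (by fun_prop) (by fun_prop),
    ← lintegral_add_left_eq_self (fun y => ENNReal.ofReal (φ (y - x)) * h y) x]
  simp

lemma compProd_shiftKernel_apply [IsProbabilityMeasure μ] [IsProbabilityMeasure ζ]
    (hφ : Measurable φ) (hζ : ζ = volume.withDensity fun x => ENNReal.ofReal (φ x))
    {h : (Fin d → ℝ) × (Fin d → ℝ) → ℝ≥0∞} (hh : Measurable h) :
    ∫⁻ p, h p ∂(μ.compProd (shiftKernel ζ)) =
      ∫⁻ y, ∫⁻ x, ENNReal.ofReal (φ (y - x)) * h (x, y) ∂μ := by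
  rw [compProd_shiftKernel, lintegral_map hh (by fun_prop),
    lintegral_prod _ (by fun_prop : AEMeasurable _ _)]
  refine Eq.trans (lintegral_congr fun x => lintegral_add_left_noise hφ hζ
    (h := fun y => h (x, y)) (by fun_prop) x) (lintegral_lintegral_swap ?_)
  exact Measurable.aemeasurable (by fun_prop)

lemma map_add_prod_eq [IsProbabilityMeasure μ] [IsProbabilityMeasure ζ] (hφ : Measurable φ)
    (hζ : ζ = volume.withDensity fun x => ENNReal.ofReal (φ x)) :
    (μ.compProd (shiftKernel ζ)).map Prod.snd = volume.withDensity (convDensity μ φ) := by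
  ext s hs
  have h := compProd_shiftKernel_apply (μ := μ) hφ hζ
    (h := fun p => s.indicator 1 p.2) (by measurability)
  rw [withDensity_apply _ hs, Measure.map_apply measurable_snd hs, ← lintegral_indicator_one
    (measurable_snd hs), ← lintegral_indicator hs]
  refine Eq.trans ?_ (h.trans (lintegral_congr fun y => ?_))
  · rfl
  · by_cases hy : y ∈ s <;> simp [hy, convDensity]

lemma convDensity_le [IsProbabilityMeasure μ] {M : ℝ} (hM : ∀ x, φ x ≤ M) (y : Fin d → ℝ) :
    convDensity μ φ y ≤ ENNReal.ofReal M :=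
  (lintegral_mono fun x => ENNReal.ofReal_le_ofReal (hM (y - x))).trans (by simp)

lemma convDensity_pos [IsProbabilityMeasure μ] (hφ : Measurable φ) (hpos : ∀ x, 0 < φ x)
    (y : Fin d → ℝ) : 0 < convDensity μ φ y := by
  rw [convDensity, lintegral_pos_iff_support (by fun_prop)]
  have : Function.support (fun x => ENNReal.ofReal (φ (y - x))) = univ := by
    ext x
    simp [hpos]
  simp [this]

lemma compProd_shiftKernel_eq_withDensity [IsProbabilityMeasure μ] [IsProbabilityMeasure ζ]
    (hφ : Measurable φ) (hpos : ∀ x, 0 < φ x) {M : ℝ} (hM : ∀ x, φ x ≤ M)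
    (hζ : ζ = volume.withDensity fun x => ENNReal.ofReal (φ x)) :
    μ.compProd (shiftKernel ζ) =
      (μ.prod ((μ.compProd (shiftKernel ζ)).map Prod.snd)).withDensity
        fun p => ENNReal.ofReal (φ (p.2 - p.1)) / convDensity μ φ p.2 := by
  have hg := measurable_convDensity (μ := μ) hφ
  have : IsProbabilityMeasure (volume.withDensity (convDensity μ φ)) := by
    rw [← map_add_prod_eq hφ hζ]
    exact Measure.isProbabilityMeasure_map (by fun_prop)
  rw [map_add_prod_eq hφ hζ]
  ext s hs
  have h := compProd_shiftKernel_apply (μ := μ) hφ hζ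
    (h := s.indicator 1) (measurable_one.indicator hs)
  rw [lintegral_indicator_one hs] at h
  have hm : Measurable fun p : (Fin d → ℝ) × (Fin d → ℝ) =>
      ENNReal.ofReal (φ (p.2 - p.1)) / convDensity μ φ p.2 := by fun_prop
  have hm' : Measurable (s.indicator fun p : (Fin d → ℝ) × (Fin d → ℝ) =>
      ENNReal.ofReal (φ (p.2 - p.1)) / convDensity μ φ p.2) := hm.indicator hs
  rw [h, withDensity_apply _ hs, ← lintegral_indicator hs, lintegral_prod_symm _ hm'.aemeasurable,
    lintegral_withDensity_eq_lintegral_mul _ hg (by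
      exact Measurable.lintegral_prod_left' hm')]
  refine lintegral_congr fun y => ?_
  rw [Pi.mul_apply, ← lintegral_const_mul _ (by fun_prop)]
  refine lintegral_congr fun x => ?_
  by_cases hx : (x, y) ∈ s
  · simp only [hx, indicator_of_mem, Pi.one_apply, mul_one]
    rw [ENNReal.mul_div_cancel (convDensity_pos hφ hpos y).ne'
      ((convDensity_le hM y).trans_lt ENNReal.ofReal_lt_top).ne]
  · simp [hx]

theorem mutualInfo_shiftKernel_le [IsProbabilityMeasure μ] [IsProbabilityMeasure ζ]
    (hφ : Measurable φ) (hpos : ∀ x, 0 < φ x) {M : ℝ} (hM : ∀ x, φ x ≤ M)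
    (hζ : ζ = volume.withDensity fun x => ENNReal.ofReal (φ x))
    (hlog : Integrable (fun z => Real.log (φ z)) ζ)
    {w : (Fin d → ℝ) → ℝ} (hwm : Measurable w) (hw0 : ∀ x, 0 < w x) (hwi : Integrable w)
    (hw1 : ∫ x, w x ≤ 1)
    (hlw : Integrable (fun p : (Fin d → ℝ) × (Fin d → ℝ) => Real.log (w (p.1 + p.2)))
      (μ.prod ζ)) :
    mutualInfo (μ.compProd (shiftKernel ζ)) ≤
      ENNReal.ofReal (∫ z, Real.log (φ z) ∂ζ - ∫ p, Real.log (w (p.1 + p.2)) ∂(μ.prod ζ)) := by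
  set π := μ.compProd (shiftKernel ζ) with hπ
  set ν := π.map Prod.snd with hν
  have hνp : IsProbabilityMeasure ν := Measure.isProbabilityMeasure_map (by fun_prop)
  have hνd : ν = volume.withDensity (convDensity μ φ) := map_add_prod_eq hφ hζ
  have hfst : π.map Prod.fst = μ := Measure.fst_compProd _ _
  have hgm := measurable_convDensity (μ := μ) hφ
  have hgtop : ∀ y, convDensity μ φ y ≠ ∞ := fun y =>
    ((convDensity_le hM y).trans_lt ENNReal.ofReal_lt_top).ne
  set g : (Fin d → ℝ) → ℝ := fun y => (convDensity μ φ y).toReal with hg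
  have hgm' : Measurable g := hgm.ennreal_toReal
  have hM0 : 0 < M := (hpos 0).trans_le (hM 0)
  have hg0 : ∀ y, 0 < g y := fun y => ENNReal.toReal_pos (convDensity_pos hφ hpos y).ne' (hgtop y)
  have hgM : ∀ y, g y ≤ M := fun y => ENNReal.toReal_le_of_le_ofReal hM0.le (convDensity_le hM y)
  have hgof : ∀ y, convDensity μ φ y = ENNReal.ofReal (g y) := fun y =>
    (ENNReal.ofReal_toReal (hgtop y)).symm
  have hνd' : ν = volume.withDensity fun y => ENNReal.ofReal (g y) := by
    rw [hνd]; exact congrArg _ (funext hgof)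
  have hπd := compProd_shiftKernel_eq_withDensity (μ := μ) hφ hpos hM hζ
  rw [← hπ, ← hν] at hπd
  set L : (Fin d → ℝ) × (Fin d → ℝ) → ℝ≥0∞ :=
    fun p => ENNReal.ofReal (φ (p.2 - p.1)) / convDensity μ φ p.2 with hL
  have hLm : Measurable L := by fun_prop
  have hac : π ≪ μ.prod ν := by rw [hπd]; exact withDensity_absolutelyContinuous _ _
  have hrn : π.rnDeriv (μ.prod ν) =ᵐ[π] L := by
    refine hac.ae_le ?_
    have h := Measure.rnDeriv_withDensity (μ.prod ν) hLm
    rwa [← hπd] at h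
  have hlogeq : (fun p => Real.log (π.rnDeriv (μ.prod ν) p).toReal) =ᵐ[π]
      fun p => Real.log (φ (p.2 - p.1)) - Real.log (g p.2) := by
    filter_upwards [hrn] with p hp
    rw [hp, hL]
    simp only
    rw [ENNReal.toReal_div, ENNReal.toReal_ofReal (hpos _).le,
      Real.log_div (hpos _).ne' (hg0 _).ne']
  have hπmap : π = (μ.prod ζ).map fun p => (p.1, p.1 + p.2) := compProd_shiftKernel μ ζ
  have hT : Measurable fun p : (Fin d → ℝ) × (Fin d → ℝ) => (p.1, p.1 + p.2) := by fun_prop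
  -- integrals with respect to the noise
  have hφi : Integrable (fun p : (Fin d → ℝ) × (Fin d → ℝ) => Real.log (φ (p.2 - p.1))) π := by
    rw [hπmap, integrable_map_measure (Measurable.aestronglyMeasurable (by fun_prop))
      (by fun_prop)]
    simpa [Function.comp_def] using hlog.comp_snd μ
  have hφint : ∫ p, Real.log (φ (p.2 - p.1)) ∂π = ∫ z, Real.log (φ z) ∂ζ := by
    rw [hπmap, integral_map (by fun_prop) (Measurable.aestronglyMeasurable (by fun_prop))]
    simp [integral_fun_snd (fun z => Real.log (φ z))]
  -- integrals with respect to the output law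
  have hνmap : ν = (μ.prod ζ).map fun p => p.1 + p.2 := by
    rw [hν, hπmap, Measure.map_map (by fun_prop) (by fun_prop)]
    rfl
  have hlwν : Integrable (fun y => Real.log (w y)) ν := by
    rw [hνmap, integrable_map_measure (Measurable.aestronglyMeasurable (by fun_prop))
      (by fun_prop)]
    exact hlw
  have hlwint : ∫ y, Real.log (w y) ∂ν = ∫ p, Real.log (w (p.1 + p.2)) ∂(μ.prod ζ) := by
    rw [hνmap, integral_map (by fun_prop) (Measurable.aestronglyMeasurable (by fun_prop))]
  have hiff : ∀ h : (Fin d → ℝ) → ℝ, Integrable h ν ↔ Integrable (fun y => g y * h y) := by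
    intro h
    rw [hνd', integrable_withDensity_iff_integrable_smul₀' (by fun_prop) (by simp)]
    simp [ENNReal.toReal_ofReal (hg0 _).le]
  have hint : ∀ h : (Fin d → ℝ) → ℝ, ∫ y, h y ∂ν = ∫ y, g y * h y := by
    intro h
    rw [hνd', integral_withDensity_eq_integral_toReal_smul₀ (by fun_prop) (by simp)]
    simp [ENNReal.toReal_ofReal (hg0 _).le]
  have hgi : Integrable g := by simpa using (hiff fun _ => 1).1 (integrable_const 1)
  have hg1 : ∫ y, g y = 1 := by
    have := hint fun _ => 1
    simpa using this.symm
  have hglw := (hiff _).1 hlwν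
  have hglg : Integrable fun y => g y * Real.log (g y) := by
    refine ((hglw.abs.add hwi).add (hgi.mul_const (1 + |Real.log M|))).mono'
      (by fun_prop) (Eventually.of_forall fun y => ?_)
    have h1 := mul_log_add_sub_le (hg0 y).le (hw0 y)
    have h2 : g y * Real.log (g y) ≤ g y * |Real.log M| :=
      mul_le_mul_of_nonneg_left ((Real.log_le_log (hg0 y) (hgM y)).trans (le_abs_self _))
        (hg0 y).le
    have h3 := neg_abs_le (g y * Real.log (w y))
    have h4 := abs_nonneg (g y * Real.log (w y))
    have h5 := mul_nonneg (hg0 y).le (abs_nonneg (Real.log M))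
    have h6 := hw0 y
    have h7 := hg0 y
    simp only [Pi.add_apply]
    rw [Real.norm_eq_abs, abs_le]
    constructor <;> linarith
  have hlgν := (hiff fun y => Real.log (g y)).2 hglg
  have hlgπ : Integrable (fun p : (Fin d → ℝ) × (Fin d → ℝ) => Real.log (g p.2)) π := by
    rw [hν, integrable_map_measure (Measurable.aestronglyMeasurable (by fun_prop))
      (by fun_prop)] at hlgν
    exact hlgν
  have hlgint : ∫ p, Real.log (g p.2) ∂π = ∫ y, g y * Real.log (g y) := by
    rw [← hint fun y => Real.log (g y), hν, integral_map (by fun_prop) (Measurable.aestronglyMeasurable (by fun_prop))]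
  have hgibbs : ∫ y, g y * Real.log (w y) ≤ ∫ y, g y * Real.log (g y) := by
    have h : ∫ y, (g y * Real.log (w y) + g y - w y) ≤ ∫ y, g y * Real.log (g y) :=
      integral_mono ((hglw.add hgi).sub hwi) hglg fun y => mul_log_add_sub_le (hg0 y).le (hw0 y)
    have h' : ∫ y, (g y * Real.log (w y) + g y - w y) =
        (∫ y, g y * Real.log (w y)) + (∫ y, g y) - ∫ y, w y := by
      rw [← integral_add hglw hgi]
      exact integral_sub (hglw.add hgi) hwi
    linarith
  have hLi : Integrable (fun p => Real.log (π.rnDeriv (μ.prod ν) p).toReal) π :=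
    (hφi.sub hlgπ).congr hlogeq.symm
  rw [mutualInfo, hfst, ← hν, klDiv, if_pos ⟨hac, hLi⟩]
  refine ENNReal.ofReal_le_ofReal ?_
  rw [integral_congr_ae hlogeq, integral_sub hφi hlgπ, hφint, hlgint, ← hlwint, hint]
  linarith

end AdditiveNoise

section FloorMixture

variable {d : ℕ} {N : (Fin d → ℝ) → ℝ} {r : ℝ} {μ : Measure (Fin d → ℝ)}

/-- The componentwise integer part. -/
def floorVec (x : Fin d → ℝ) : Fin d → ℤ := fun j => ⌊x j⌋

lemma measurable_floorVec : Measurable (floorVec (d := d)) :=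
  measurable_pi_lambda _ fun j => Int.measurable_floor.comp (measurable_pi_apply j)

/-- The probability mass function of the integer part. -/
def floorProb (μ : Measure (Fin d → ℝ)) (k : Fin d → ℤ) : ℝ :=
  (μ {x | ∀ j, ⌊x j⌋ = k j}).toReal

lemma map_floorVec_singleton (k : Fin d → ℤ) :
    μ.map floorVec {k} = μ {x | ∀ j, ⌊x j⌋ = k j} := by
  rw [Measure.map_apply measurable_floorVec (measurableSet_singleton k)]
  congr 1
  ext x
  simp [floorVec, funext_iff]

lemma floorProb_nonneg (k : Fin d → ℤ) : 0 ≤ floorProb μ k := ENNReal.toReal_nonneg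

lemma floorProb_le_one [IsProbabilityMeasure μ] (k : Fin d → ℤ) : floorProb μ k ≤ 1 :=
  measureReal_le_one

lemma ofReal_floorProb [IsProbabilityMeasure μ] (k : Fin d → ℤ) :
    ENNReal.ofReal (floorProb μ k) = μ.map floorVec {k} := by
  rw [map_floorVec_singleton, floorProb, ENNReal.ofReal_toReal (measure_ne_top _ _)]

lemma tsum_ofReal_floorProb [IsProbabilityMeasure μ] :
    ∑' k, ENNReal.ofReal (floorProb μ k) = 1 := by
  have : IsProbabilityMeasure (μ.map floorVec) :=
    Measure.isProbabilityMeasure_map measurable_floorVec.aemeasurable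
  have h := lintegral_countable' (μ := μ.map floorVec) 1
  simp only [Pi.one_apply, lintegral_one, measure_univ, one_mul] at h
  simp_rw [ofReal_floorProb]
  exact h.symm

lemma hasSum_floorProb [IsProbabilityMeasure μ] : HasSum (floorProb μ) 1 := by
  have h : Summable (floorProb μ) := by
    have := ENNReal.summable_toReal (f := fun k => ENNReal.ofReal (floorProb μ k))
      (by rw [tsum_ofReal_floorProb]; simp)
    simpa [ENNReal.toReal_ofReal (floorProb_nonneg _)] using this
  have h2 := ENNReal.ofReal_tsum_of_nonneg floorProb_nonneg h
  rw [tsum_ofReal_floorProb, ENNReal.ofReal_eq_one] at h2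
  exact h2 ▸ h.hasSum

lemma ae_floorProb_pos [IsProbabilityMeasure μ] : ∀ᵐ x ∂μ, 0 < floorProb μ (floorVec x) := by
  refine ae_of_ae_map measurable_floorVec.aemeasurable (p := fun k => 0 < floorProb μ k) ?_
  rw [ae_iff_of_countable]
  intro k hk
  rw [← ofReal_floorProb] at hk
  exact ENNReal.ofReal_pos.1 (pos_iff_ne_zero.2 hk)

lemma integrable_log_floorProb [IsProbabilityMeasure μ]
    (hfloor : Summable fun k : Fin d → ℤ => Real.negMulLog (floorProb μ k)) :
    Integrable (fun x => Real.log (floorProb μ (floorVec x))) μ := by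
  have h0 : ∀ k, 0 ≤ -Real.log (floorProb μ k) := fun k =>
    neg_nonneg.2 (Real.log_nonpos (floorProb_nonneg k) (floorProb_le_one k))
  suffices h : Integrable (fun x => -Real.log (floorProb μ (floorVec x))) μ by simpa using h.neg
  have hm : Measurable fun x => Real.log (floorProb μ (floorVec x)) :=
    (measurable_of_countable fun k => Real.log (floorProb μ k)).comp measurable_floorVec
  refine ⟨hm.neg.aestronglyMeasurable, ?_⟩
  rw [hasFiniteIntegral_iff_ofReal (Eventually.of_forall fun x => h0 _)]
  have h : ∫⁻ x, ENNReal.ofReal (-Real.log (floorProb μ (floorVec x))) ∂μ =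
      ∑' k, ENNReal.ofReal (Real.negMulLog (floorProb μ k)) := by
    rw [← lintegral_map (f := fun k => ENNReal.ofReal (-Real.log (floorProb μ k)))
      (measurable_of_countable _) measurable_floorVec, lintegral_countable']
    refine tsum_congr fun k => ?_
    rw [← ofReal_floorProb, ← ENNReal.ofReal_mul (h0 k), Real.negMulLog]
    ring_nf
  rw [h]
  exact hfloor.tsum_ofReal_lt_top

/-- The embedding of the integer lattice. -/
def latticePoint (k : Fin d → ℤ) : Fin d → ℝ := fun j => k j

/-- The mixture of copies of `exp (-N ^ r)` located at the integer lattice, weighted by the law of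
the integer part. -/
def floorMixture (N : (Fin d → ℝ) → ℝ) (r : ℝ) (μ : Measure (Fin d → ℝ)) (x : Fin d → ℝ) : ℝ :=
  ∑' k, floorProb μ k * Real.exp (-N (x - latticePoint k) ^ r)

lemma floorMixture_term_nonneg (k : Fin d → ℤ) (x : Fin d → ℝ) :
    0 ≤ floorProb μ k * Real.exp (-N (x - latticePoint k) ^ r) :=
  mul_nonneg (floorProb_nonneg k) (Real.exp_pos _).le

lemma floorMixture_term_le (hN : IsNorm N) (k : Fin d → ℤ) (x : Fin d → ℝ) :
    floorProb μ k * Real.exp (-N (x - latticePoint k) ^ r) ≤ floorProb μ k :=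
  mul_le_of_le_one_right (floorProb_nonneg k)
    (Real.exp_le_one_iff.2 (neg_nonpos.2 (hN.rpow_nonneg _ _)))

lemma summable_floorMixture [IsProbabilityMeasure μ] (hN : IsNorm N) (x : Fin d → ℝ) :
    Summable fun k => floorProb μ k * Real.exp (-N (x - latticePoint k) ^ r) :=
  hasSum_floorProb.summable.of_nonneg_of_le (fun k => floorMixture_term_nonneg k x)
    fun k => floorMixture_term_le hN k x

lemma le_floorMixture [IsProbabilityMeasure μ] (hN : IsNorm N) (k : Fin d → ℤ) (x : Fin d → ℝ) :
    floorProb μ k * Real.exp (-N (x - latticePoint k) ^ r) ≤ floorMixture N r μ x :=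
  (summable_floorMixture hN x).le_tsum k fun j _ => floorMixture_term_nonneg j x

lemma floorMixture_le_one [IsProbabilityMeasure μ] (hN : IsNorm N) (x : Fin d → ℝ) :
    floorMixture N r μ x ≤ 1 := by
  rw [← (hasSum_floorProb (μ := μ)).tsum_eq]
  exact (summable_floorMixture hN x).tsum_le_tsum (fun k => floorMixture_term_le hN k x)
    hasSum_floorProb.summable

lemma floorMixture_pos [IsProbabilityMeasure μ] (hN : IsNorm N) (x : Fin d → ℝ) :
    0 < floorMixture N r μ x := by
  obtain ⟨y, hy⟩ := (ae_floorProb_pos (μ := μ)).exists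
  exact (mul_pos hy (Real.exp_pos _)).trans_le (le_floorMixture hN _ x)

lemma continuous_floorMixture [IsProbabilityMeasure μ] (hN : IsNorm N) (hr : 0 < r) :
    Continuous (floorMixture N r μ) := by
  refine continuous_tsum (fun k => ?_) (hasSum_floorProb (μ := μ)).summable fun k x => ?_
  · exact continuous_const.mul (Real.continuous_exp.comp
      ((hN.continuous_rpow hr).comp (continuous_id.sub continuous_const)).neg)
  · rw [Real.norm_of_nonneg (floorMixture_term_nonneg k x)]
    exact floorMixture_term_le hN k x

lemma lintegral_floorMixture [IsProbabilityMeasure μ] (hN : IsNorm N) (hr : 0 < r) :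
    ∫⁻ x, ENNReal.ofReal (floorMixture N r μ x) =
      ENNReal.ofReal (∫ x, Real.exp (-(N x) ^ r)) := by
  have h : ∀ x, ENNReal.ofReal (floorMixture N r μ x) = ∑' k, ENNReal.ofReal (floorProb μ k) *
      ENNReal.ofReal (Real.exp (-N (x - latticePoint k) ^ r)) := fun x => by
    rw [floorMixture, ENNReal.ofReal_tsum_of_nonneg (fun k => floorMixture_term_nonneg k x)
      (summable_floorMixture hN x)]
    exact tsum_congr fun k => ENNReal.ofReal_mul (floorProb_nonneg k)
  have hc : Continuous fun x => Real.exp (-(N x) ^ r) :=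
    Real.continuous_exp.comp (hN.continuous_rpow hr).neg
  have hm : ∀ k : Fin d → ℤ, Measurable fun x : Fin d → ℝ =>
      ENNReal.ofReal (Real.exp (-N (x - latticePoint k) ^ r)) := fun k =>
    (hc.comp (continuous_id.sub continuous_const)).measurable.ennreal_ofReal
  simp_rw [h]
  rw [lintegral_tsum fun k => ((hm k).const_mul _).aemeasurable]
  have h2 : ∀ k : Fin d → ℤ, ∫⁻ x, ENNReal.ofReal (floorProb μ k) *
      ENNReal.ofReal (Real.exp (-N (x - latticePoint k) ^ r)) =
      ENNReal.ofReal (floorProb μ k) * ENNReal.ofReal (∫ x, Real.exp (-(N x) ^ r)) := fun k => by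
    rw [lintegral_const_mul _ (hm k), lintegral_sub_right_eq_self
      (fun x => ENNReal.ofReal (Real.exp (-N x ^ r))) (latticePoint k),
      ofReal_integral_eq_lintegral_ofReal (hN.integrable_exp hr)
        (Eventually.of_forall fun x => (Real.exp_pos _).le)]
  simp_rw [h2]
  rw [ENNReal.tsum_mul_right, tsum_ofReal_floorProb, one_mul]

lemma integrable_floorMixture [IsProbabilityMeasure μ] (hN : IsNorm N) (hr : 0 < r) :
    Integrable (floorMixture N r μ) := by
  refine ⟨(continuous_floorMixture hN hr).aestronglyMeasurable, ?_⟩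
  rw [hasFiniteIntegral_iff_ofReal (Eventually.of_forall fun x => (floorMixture_pos hN x).le),
    lintegral_floorMixture hN hr]
  exact ENNReal.ofReal_lt_top

lemma exists_neg_log_floorMixture_le [IsProbabilityMeasure μ] (hN : IsNorm N) (hr : 0 < r) :
    ∃ C, ∀ᵐ x ∂μ, ∀ z, -Real.log (floorMixture N r μ (x + z)) ≤
      C - Real.log (floorProb μ (floorVec x)) + 2 ^ r * N z ^ r := by
  obtain ⟨C, hC, hNC⟩ := hN.exists_le_mul_norm
  refine ⟨2 ^ r * C ^ r, ?_⟩
  filter_upwards [ae_floorProb_pos (μ := μ)] with x hx z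
  have h1 := Real.log_le_log (mul_pos hx (Real.exp_pos _))
    (le_floorMixture (r := r) (μ := μ) hN (floorVec x) (x + z))
  rw [Real.log_mul hx.ne' (Real.exp_pos _).ne', Real.log_exp] at h1
  have h2 : N (x - latticePoint (floorVec x)) ≤ C := by
    refine (hNC _).trans (mul_le_of_le_one_right hC.le ?_)
    refine (pi_norm_le_iff_of_nonneg zero_le_one).2 fun j => ?_
    simp only [Pi.sub_apply, latticePoint, floorVec, Int.self_sub_floor]
    rw [Real.norm_of_nonneg (Int.fract_nonneg _)]
    exact (Int.fract_lt_one _).le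
  have h3 := hN.add_rpow_le hr (x - latticePoint (floorVec x)) z
  have h4 := Real.rpow_le_rpow (hN.nonneg _) h2 hr.le
  have h5 : x + z - latticePoint (floorVec x) = x - latticePoint (floorVec x) + z := by abel
  rw [h5] at h1
  have h6 : (0 : ℝ) < 2 ^ r := by positivity
  nlinarith

end FloorMixture

lemma IsNorm.exists_norm_le {d : ℕ} {N : (Fin d → ℝ) → ℝ} (hN : IsNorm N) :
    ∃ c, 0 < c ∧ ∀ x, ‖x‖ ≤ c * N x := by
  rcases (Metric.sphere (0 : Fin d → ℝ) 1).eq_empty_or_nonempty with h | h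
  · refine ⟨1, one_pos, fun x => ?_⟩
    by_cases hx : x = 0
    · simp [hx, hN.map_zero]
    · have : ‖x‖⁻¹ • x ∈ Metric.sphere (0 : Fin d → ℝ) 1 := by
        simp [norm_smul, hx]
      simp [h] at this
  · obtain ⟨y, hy, hmin⟩ := (isCompact_sphere (0 : Fin d → ℝ) 1).exists_isMinOn h
      hN.continuous.continuousOn
    have hy0 : y ≠ 0 := by
      rintro rfl
      simp at hy
    have hNy : 0 < N y := (hN.nonneg y).lt_of_ne fun h => hy0 ((hN.eq_zero_iff y).1 h.symm)
    refine ⟨(N y)⁻¹, by positivity, fun x => ?_⟩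
    by_cases hx : x = 0
    · simp [hx, hN.map_zero]
    · have hx' : 0 < ‖x‖ := norm_pos_iff.2 hx
      have h1 : N y ≤ N (‖x‖⁻¹ • x) := hmin (by simp [norm_smul, hx])
      rw [hN.smul, abs_of_pos (by positivity)] at h1
      rw [inv_mul_eq_div, le_div_iff₀ hNy]
      rw [inv_mul_eq_div, le_div_iff₀ hx'] at h1
      linarith

lemma exists_setIntegral_le {α : Type*} [MeasurableSpace α] {μ : Measure α} {Q : α → ℝ}
    (hQ : Integrable Q μ) {ε : ℝ} (hε : 0 < ε) :
    ∃ θ, 0 < θ ∧ ∀ B, μ B ≤ ENNReal.ofReal θ → ∫ x in B, Q x ∂μ ≤ ε := by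
  have h := hQ.tendsto_setIntegral_nhds_zero (l := Filter.comap μ (𝓝 0)) (s := id)
    (by simpa using tendsto_comap)
  have h2 := h.eventually (Iic_mem_nhds hε)
  rw [eventually_comap] at h2
  obtain ⟨a, ha, h3⟩ := (ENNReal.nhds_zero_basis.eventually_iff).1 h2
  obtain ⟨θ, hθ0, hθa⟩ := ENNReal.lt_iff_exists_nnreal_btwn.1 ha
  refine ⟨θ, by exact_mod_cast hθ0, fun B hB => h3 (lt_of_le_of_lt hB ?_) B rfl⟩
  simpa using hθa

/-- `f` is a probability density of `μ` with finite differential entropy. -/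
structure IsSource {d : ℕ} (μ : Measure (Fin d → ℝ)) (f : (Fin d → ℝ) → ℝ) : Prop where
  measurable : Measurable f
  nonneg : ∀ x, 0 ≤ f x
  eq : μ = volume.withDensity fun x => ENNReal.ofReal (f x)
  ent : Integrable fun x => f x * Real.log (f x)

namespace IsSource

variable {d : ℕ} {N : (Fin d → ℝ) → ℝ} {μ : Measure (Fin d → ℝ)} {f : (Fin d → ℝ) → ℝ}

lemma integrable_iff (h : IsSource μ f) (g : (Fin d → ℝ) → ℝ) :
    Integrable g μ ↔ Integrable fun x => f x * g x := by
  have := h.measurable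
  rw [h.eq, integrable_withDensity_iff_integrable_smul₀' (by fun_prop) (by simp)]
  simp [ENNReal.toReal_ofReal (h.nonneg _)]

lemma setIntegral_eq (h : IsSource μ f) (g : (Fin d → ℝ) → ℝ) {s : Set (Fin d → ℝ)}
    (hs : MeasurableSet s) : ∫ x in s, g x ∂μ = ∫ x in s, f x * g x := by
  have := h.measurable
  rw [h.eq, restrict_withDensity hs,
    integral_withDensity_eq_integral_toReal_smul₀ (by fun_prop) (by simp)]
  simp [ENNReal.toReal_ofReal (h.nonneg _)]

lemma integral_eq (h : IsSource μ f) (g : (Fin d → ℝ) → ℝ) :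
    ∫ x, g x ∂μ = ∫ x, f x * g x := by
  simpa using h.setIntegral_eq g MeasurableSet.univ

lemma integrable [IsProbabilityMeasure μ] (h : IsSource μ f) : Integrable f := by
  simpa using (h.integrable_iff fun _ => 1).1 (integrable_const 1)

lemma integral_eq_one [IsProbabilityMeasure μ] (h : IsSource μ f) : ∫ x, f x = 1 := by
  simpa using (h.integral_eq fun _ => 1).symm

lemma integrable_log (h : IsSource μ f) : Integrable (fun x => Real.log (f x)) μ :=
  (h.integrable_iff _).2 h.ent

lemma ae_pos (h : IsSource μ f) : ∀ᵐ x ∂μ, 0 < f x := by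
  have := h.measurable
  rw [h.eq, ae_withDensity_iff (by fun_prop)]
  exact Eventually.of_forall fun x hx => by simpa using hx

lemma measureReal_eq (h : IsSource μ f) {s : Set (Fin d → ℝ)} (hs : MeasurableSet s) :
    μ.real s = ∫ x in s, f x := by
  have := h.setIntegral_eq (fun _ => 1) hs
  simpa using this

/-- `L¹`-approximation of the density by continuous functions. -/
lemma exists_approx [IsProbabilityMeasure μ] (h : IsSource μ f) {δ θ : ℝ} (hδ : 0 < δ) (hθ : 0 < θ) :
    ∃ φ : (Fin d → ℝ) → ℝ, Continuous φ ∧ HasCompactSupport φ ∧ (∀ x, 0 ≤ φ x) ∧ Integrable φ ∧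
      ∫ x, φ x ≤ 1 + θ ∧ μ {x | |f x - φ x| ≤ δ * f x}ᶜ ≤ ENNReal.ofReal θ := by
  obtain ⟨φ₀, hc, hle, hcont, hint⟩ := h.integrable.exists_hasCompactSupport_integral_sub_le
    (ε := min θ (δ * θ)) (by positivity)
  set φ : (Fin d → ℝ) → ℝ := fun x => max (φ₀ x) 0 with hφ
  have hφc : Continuous φ := by fun_prop
  have hφs : HasCompactSupport φ := hc.comp_left (g := fun y => max y 0) (by simp)
  have hφi : Integrable φ := hφc.integrable_of_hasCompactSupport hφs
  have hsub : ∀ x, |f x - φ x| ≤ ‖f x - φ₀ x‖ := fun x => by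
    have := h.nonneg x
    rw [Real.norm_eq_abs]
    simp only [hφ]
    rcases le_total (φ₀ x) 0 with h0 | h0
    · rw [max_eq_right h0, abs_of_nonneg (by linarith), abs_of_nonneg (by linarith)]
      linarith
    · rw [max_eq_left h0]
  have hint' : Integrable fun x => |f x - φ x| := (h.integrable.sub hφi).abs
  have hle' : ∫ x, |f x - φ x| ≤ min θ (δ * θ) :=
    (integral_mono hint' (h.integrable.sub hint).norm hsub).trans hle
  refine ⟨φ, hφc, hφs, fun x => le_max_right _ _, hφi, ?_, ?_⟩
  · have h1 : ∫ x, φ x ≤ ∫ x, (f x + |f x - φ x|) :=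
      integral_mono hφi (h.integrable.add hint') fun x => by
        have := neg_abs_le (f x - φ x)
        simp only
        linarith
    rw [integral_add h.integrable hint', h.integral_eq_one] at h1
    linarith [min_le_left θ (δ * θ)]
  · have hfm := h.measurable
    have hms : MeasurableSet {x | |f x - φ x| ≤ δ * f x}ᶜ :=
      (measurableSet_le (by fun_prop) (by fun_prop)).compl
    rw [← ofReal_measureReal (measure_ne_top _ _)]
    refine ENNReal.ofReal_le_ofReal ?_
    rw [h.measureReal_eq hms]
    have h1 : ∫ x in {x | |f x - φ x| ≤ δ * f x}ᶜ, δ * f x ≤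
        ∫ x in {x | |f x - φ x| ≤ δ * f x}ᶜ, |f x - φ x| := by
      refine setIntegral_mono_on (h.integrable.const_mul δ).integrableOn hint'.integrableOn hms
        fun x hx => ?_
      have hx' : δ * f x < |f x - φ x| := by simpa using hx
      exact hx'.le
    have h2 := setIntegral_le_integral (s := {x | |f x - φ x| ≤ δ * f x}ᶜ) hint'
      (Eventually.of_forall fun x => abs_nonneg _)
    rw [integral_const_mul] at h1
    have h3 := min_le_right θ (δ * θ)
    exact le_of_mul_le_mul_left (by linarith) hδ

/-- Outside a set of small probability the density has small local oscillation. -/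
lemma exists_oscillation_le [IsProbabilityMeasure μ] (h : IsSource μ f) (hN : IsNorm N) {lam θ : ℝ} (hl : 1 < lam)
    (hθ : 0 < θ) :
    ∃ (K : Set (Fin d → ℝ)) (ρ : ℝ), MeasurableSet K ∧ 0 < ρ ∧ μ.real Kᶜ ≤ θ ∧
      (∀ x ∈ K, 0 < f x) ∧ ∀ x ∈ K, ∀ y ∈ K, N (x - y) < ρ → f x ≤ lam * f y := by
  have hfm := h.measurable
  set δ := (lam - 1) / (lam + 2) with hδ
  have hδ0 : 0 < δ := div_pos (by linarith) (by linarith)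
  have hδl : 1 + 2 * δ = lam * (1 - δ) := by rw [hδ]; field_simp; ring
  have hδ1 : 0 < 1 - δ := by
    have : 0 < lam * (1 - δ) := by rw [← hδl]; linarith
    exact (pos_iff_pos_of_mul_pos this).1 (by linarith)
  obtain ⟨φ, hφc, hφs, -, -, -, hbad⟩ := h.exists_approx hδ0 (half_pos hθ)
  set A := ∫ x, |Real.log (f x)| ∂μ with hA
  have hA0 : 0 ≤ A := integral_nonneg fun x => abs_nonneg _
  set T := (A + 1) * (2 / θ) with hT
  have hT0 : 0 < T := by positivity
  have hmark : μ.real {x | T ≤ |Real.log (f x)|} ≤ θ / 2 := by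
    have := mul_meas_ge_le_integral_of_nonneg (μ := μ)
      (Eventually.of_forall fun x => abs_nonneg (Real.log (f x))) h.integrable_log.abs T
    have h1 : T * (θ / 2) = A + 1 := by rw [hT]; field_simp
    exact le_of_mul_le_mul_left (by linarith) hT0
  obtain ⟨c, hc, hcN⟩ := hN.exists_norm_le
  have huc : UniformContinuous φ := hφs.uniformContinuous_of_continuous hφc
  obtain ⟨τ, hτ, hτφ⟩ := Metric.uniformContinuous_iff.1 huc (δ * Real.exp (-T)) (by positivity)
  set K := {x | |f x - φ x| ≤ δ * f x} ∩ ({x | T ≤ |Real.log (f x)|}ᶜ ∩ {x | 0 < f x}) with hK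
  have hm1 : MeasurableSet {x | |f x - φ x| ≤ δ * f x} :=
    measurableSet_le (by fun_prop) (by fun_prop)
  have hm2 : MeasurableSet {x | T ≤ |Real.log (f x)|} :=
    measurableSet_le (by fun_prop) (by fun_prop)
  have hm3 : MeasurableSet {x | 0 < f x} := measurableSet_lt (by fun_prop) (by fun_prop)
  refine ⟨K, τ / c, hm1.inter (hm2.compl.inter hm3), by positivity, ?_, fun x hx => by simpa using hx.2.2, ?_⟩
  · have hz : μ.real {x | 0 < f x}ᶜ = 0 := by
      rw [measureReal_def, show {x | 0 < f x}ᶜ = {x | ¬ 0 < f x} from rfl, ae_iff.1 h.ae_pos,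
        ENNReal.toReal_zero]
    have hb : μ.real {x | |f x - φ x| ≤ δ * f x}ᶜ ≤ θ / 2 :=
      ENNReal.toReal_le_of_le_ofReal (by positivity) hbad
    rw [hK, compl_inter, compl_inter, compl_compl]
    have h1 := measureReal_union_le (μ := μ) {x | |f x - φ x| ≤ δ * f x}ᶜ
      ({x | T ≤ |Real.log (f x)|} ∪ {x | 0 < f x}ᶜ)
    have h2 := measureReal_union_le (μ := μ) {x | T ≤ |Real.log (f x)|} {x | 0 < f x}ᶜ
    linarith
  · intro x hx y hy hxy
    have hKmem : ∀ z, z ∈ K ↔ |f z - φ z| ≤ δ * f z ∧ |Real.log (f z)| < T ∧ 0 < f z := by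
      simp [hK]
    rw [hKmem] at hx hy
    have hd : dist x y < τ := by
      rw [dist_eq_norm]
      refine (hcN _).trans_lt ?_
      rwa [lt_div_iff₀ hc, mul_comm] at hxy
    have h1 := hτφ hd
    rw [Real.dist_eq] at h1
    have h2 := (abs_le.1 hx.1).2
    have h3 := (abs_le.1 hy.1).1
    have h4 := (abs_lt.1 h1).2
    have h5 : Real.exp (-T) ≤ f y := by
      rw [← Real.le_log_iff_exp_le hy.2.2]
      have h6 : |Real.log (f y)| < T := hy.2.1
      linarith [(abs_lt.1 h6).1]
    have h6 : δ * Real.exp (-T) ≤ δ * f y := by gcongr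
    refine le_of_mul_le_mul_left (a := 1 - δ) ?_ hδ1
    have h7 : (1 - δ) * (lam * f y) = (1 + 2 * δ) * f y := by rw [hδl]; ring
    rw [h7]
    linarith

end IsSource

section Reference

variable {d : ℕ} {N : (Fin d → ℝ) → ℝ} {r : ℝ} {μ : Measure (Fin d → ℝ)} {f : (Fin d → ℝ) → ℝ}

/-- A bounded positive continuous `v` whose logarithm has controlled translates. -/
structure IsReference (N : (Fin d → ℝ) → ℝ) (r : ℝ) (μ : Measure (Fin d → ℝ))
    (v : (Fin d → ℝ) → ℝ) : Prop where
  continuous : Continuous v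
  pos : ∀ x, 0 < v x
  integrable : Integrable v
  bdd : ∃ M, ∀ x, v x ≤ M
  neg_log_le : ∃ (b : (Fin d → ℝ) → ℝ) (C : ℝ), Integrable b μ ∧
    ∀ᵐ x ∂μ, ∀ z, -Real.log (v (x + z)) ≤ b x + C * N z ^ r

lemma IsReference.exists_abs_log_le {v : (Fin d → ℝ) → ℝ} [IsProbabilityMeasure μ]
    (hv : IsReference N r μ v) (hN : IsNorm N) :
    ∃ (b : (Fin d → ℝ) → ℝ) (C : ℝ), 0 ≤ C ∧ Integrable b μ ∧
      ∀ᵐ x ∂μ, ∀ z, |Real.log (v (x + z))| ≤ b x + C * N z ^ r := by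
  obtain ⟨M, hM⟩ := hv.bdd
  obtain ⟨b, C, hb, h⟩ := hv.neg_log_le
  refine ⟨fun x => |b x| + |Real.log M|, |C|, abs_nonneg _, hb.abs.add (integrable_const _), ?_⟩
  filter_upwards [h] with x hx z
  have h1 := hx z
  have h2 := Real.log_le_log (hv.pos (x + z)) (hM (x + z))
  have h3 := mul_le_mul_of_nonneg_right (le_abs_self C) (hN.rpow_nonneg r z)
  have h4 := mul_nonneg (abs_nonneg C) (hN.rpow_nonneg r z)
  have h5 := le_abs_self (b x)
  have h6 := le_abs_self (Real.log M)
  have h7 := abs_nonneg (b x)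
  have h8 := abs_nonneg (Real.log M)
  rw [abs_le]
  constructor <;> linarith

lemma IsReference.integrable_log {v : (Fin d → ℝ) → ℝ} [IsProbabilityMeasure μ]
    (hv : IsReference N r μ v) (hN : IsNorm N) :
    Integrable (fun x => Real.log (v x)) μ := by
  obtain ⟨b, C, -, hb, h⟩ := hv.exists_abs_log_le hN
  have := hv.continuous.measurable
  refine (hb.add (integrable_const (C * N 0 ^ r))).mono'
    (Measurable.aestronglyMeasurable (by fun_prop)) ?_
  filter_upwards [h] with x hx
  simpa using hx 0

lemma isReference_floorMixture [IsProbabilityMeasure μ] (hN : IsNorm N) (hr : 0 < r)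
    (hfloor : Summable fun k : Fin d → ℤ => Real.negMulLog (floorProb μ k)) :
    IsReference N r μ (floorMixture N r μ) where
  continuous := continuous_floorMixture hN hr
  pos := floorMixture_pos hN
  integrable := integrable_floorMixture hN hr
  bdd := ⟨1, floorMixture_le_one hN⟩
  neg_log_le := by
    obtain ⟨C, hC⟩ := exists_neg_log_floorMixture_le (μ := μ) hN hr
    exact ⟨_, _, (integrable_const C).sub (integrable_log_floorProb hfloor), hC⟩

lemma IsReference.add_const_mul {φ G : (Fin d → ℝ) → ℝ} [IsProbabilityMeasure μ]
    (hG : IsReference N r μ G) (hφ : Continuous φ) (hφ0 : ∀ x, 0 ≤ φ x)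
    (hφs : HasCompactSupport φ) {η : ℝ} (hη : 0 < η) :
    IsReference N r μ fun x => φ x + η * G x where
  continuous := hφ.add (continuous_const.mul hG.continuous)
  pos x := add_pos_of_nonneg_of_pos (hφ0 x) (mul_pos hη (hG.pos x))
  integrable := (hφ.integrable_of_hasCompactSupport hφs).add (hG.integrable.const_mul η)
  bdd := by
    obtain ⟨M, hM⟩ := hG.bdd
    obtain ⟨L, hL⟩ := hφ.bounded_above_of_compact_support hφs
    exact ⟨L + η * M, fun x => add_le_add ((le_abs_self _).trans (hL x))
      (mul_le_mul_of_nonneg_left (hM x) hη.le)⟩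
  neg_log_le := by
    obtain ⟨b, C, hb, h⟩ := hG.neg_log_le
    refine ⟨_, C, hb.add (integrable_const (-Real.log η)), ?_⟩
    filter_upwards [h] with x hx z
    have h1 := hx z
    have h2 := Real.log_le_log (mul_pos hη (hG.pos (x + z)))
      (le_add_of_nonneg_left (hφ0 (x + z)) : _ ≤ φ (x + z) + η * G (x + z))
    rw [Real.log_mul hη.ne' (hG.pos _).ne'] at h2
    simp only [Pi.add_apply]
    linarith

lemma IsSource.exists_reference [IsProbabilityMeasure μ] (h : IsSource μ f) (hN : IsNorm N)
    (hr : 0 < r) (hfloor : Summable fun k : Fin d → ℤ => Real.negMulLog (floorProb μ k))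
    {ε : ℝ} (hε : 0 < ε) :
    ∃ v, IsReference N r μ v ∧ ∫ x, v x ≤ 1 + ε ∧
      ∫ x, Real.log (f x) ∂μ - ∫ x, Real.log (v x) ∂μ ≤ ε := by
  have hG := isReference_floorMixture hN hr hfloor
  set G := floorMixture N r μ with hGdef
  have hGi0 : 0 ≤ ∫ x, G x := integral_nonneg fun x => (hG.pos x).le
  obtain ⟨η, hη, hηG⟩ : ∃ η, 0 < η ∧ η * ∫ x, G x ≤ ε / 2 := by
    refine ⟨ε / 2 / (1 + ∫ x, G x), by positivity, ?_⟩
    rw [div_mul_eq_mul_div, div_le_iff₀ (by positivity)]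
    nlinarith
  set Q : (Fin d → ℝ) → ℝ := fun x => |Real.log (f x)| + |Real.log η| + |Real.log (G x)| with hQ
  have hQi : Integrable Q μ :=
    (h.integrable_log.abs.add (integrable_const _)).add (hG.integrable_log hN).abs
  obtain ⟨θ, hθ, hθQ⟩ := exists_setIntegral_le hQi (half_pos hε)
  set δ := 1 - Real.exp (-(ε / 2)) with hδ
  have hδ0 : 0 < δ := by
    rw [hδ, sub_pos, Real.exp_lt_one_iff]
    linarith
  obtain ⟨φ, hφc, hφs, hφ0, hφi, hφ1, hbad⟩ :=
    h.exists_approx hδ0 (lt_min hθ (half_pos hε))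
  set v : (Fin d → ℝ) → ℝ := fun x => φ x + η * G x with hv
  have hvR : IsReference N r μ v := hG.add_const_mul hφc hφ0 hφs hη
  refine ⟨v, hvR, ?_, ?_⟩
  · rw [hv, integral_add hφi (hG.integrable.const_mul η), integral_const_mul]
    linarith [min_le_right θ (ε / 2)]
  · set A := {x | |f x - φ x| ≤ δ * f x}ᶜ with hA
    have hfm := h.measurable
    have hAm : MeasurableSet A := (measurableSet_le (by fun_prop) (by fun_prop)).compl
    rw [← integral_sub h.integrable_log (hvR.integrable_log hN)]
    have key : ∀ᵐ x ∂μ, Real.log (f x) - Real.log (v x) ≤ ε / 2 + A.indicator Q x := by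
      filter_upwards [h.ae_pos] with x hx
      by_cases hxA : x ∈ A
      · rw [indicator_of_mem hxA]
        have h2 := Real.log_le_log (mul_pos hη (hG.pos x))
          (le_add_of_nonneg_left (hφ0 x) : _ ≤ φ x + η * G x)
        rw [Real.log_mul hη.ne' (hG.pos _).ne'] at h2
        have h3 := le_abs_self (Real.log (f x))
        have h4 := neg_le_abs (Real.log η)
        have h5 := neg_le_abs (Real.log (G x))
        simp only [hQ]
        linarith
      · rw [indicator_of_notMem hxA]
        have h1 : |f x - φ x| ≤ δ * f x := by simpa [hA] using hxA
        have h2 : Real.exp (-(ε / 2)) * f x ≤ v x := by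
          have h3 := (abs_le.1 h1).2
          have h4 := mul_pos hη (hG.pos x)
          simp only [hv]
          have h5 : δ * f x = f x - Real.exp (-(ε / 2)) * f x := by rw [hδ]; ring
          linarith
        have h3 := Real.log_le_log (by positivity) h2
        rw [Real.log_mul (Real.exp_pos _).ne' hx.ne', Real.log_exp] at h3
        linarith
    have hfin : ∫ x, (Real.log (f x) - Real.log (v x)) ∂μ ≤
        ∫ x, (ε / 2 + A.indicator Q x) ∂μ :=
      integral_mono_ae (h.integrable_log.sub (hvR.integrable_log hN))
        ((integrable_const _).add (hQi.indicator hAm)) key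
    rw [integral_add (integrable_const _) (hQi.indicator hAm), integral_indicator hAm] at hfin
    have h6 := hθQ A (hbad.trans (ENNReal.ofReal_le_ofReal (min_le_left _ _)))
    simp only [integral_const, probReal_univ, smul_eq_mul, one_mul] at hfin
    refine hfin.trans ?_
    linarith

end Reference

section GammaNoise

variable {d : ℕ} {N : (Fin d → ℝ) → ℝ} {r : ℝ} {μ : Measure (Fin d → ℝ)} {f : (Fin d → ℝ) → ℝ}

/-- The density proportional to `exp (-(N z / t) ^ r)`. -/
def noiseDensity (N : (Fin d → ℝ) → ℝ) (r t : ℝ) (z : Fin d → ℝ) : ℝ :=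
  Real.exp (-(t ^ (-r) * N z ^ r)) / (IsNorm.ballVol N * Real.Gamma (1 + d / r) * t ^ d)

/-- The law with density `noiseDensity N r t`. -/
def noiseLaw (N : (Fin d → ℝ) → ℝ) (r t : ℝ) : Measure (Fin d → ℝ) :=
  volume.withDensity fun z => ENNReal.ofReal (noiseDensity N r t z)

lemma noiseDensity_pos (hN : IsNorm N) (hr : 0 < r) {t : ℝ} (ht : 0 < t) (z : Fin d → ℝ) :
    0 < noiseDensity N r t z := by
  have := hN.ballVol_pos
  have := IsNorm.gamma_pos d hr
  unfold noiseDensity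
  positivity

lemma measurable_noiseDensity (hN : IsNorm N) {t : ℝ} : Measurable (noiseDensity N r t) := by
  have := hN.measurable
  unfold noiseDensity
  fun_prop

lemma integral_noiseDensity (hN : IsNorm N) (hr : 0 < r) {t : ℝ} (ht : 0 < t) :
    ∫ z, noiseDensity N r t z = 1 := by
  have h1 := hN.ballVol_pos
  have h2 := IsNorm.gamma_pos d hr
  unfold noiseDensity
  rw [integral_div, hN.integral_exp_mul hr (by positivity), ← Real.rpow_mul ht.le]
  have : -r * -((d : ℝ) / r) = d := by field_simp
  rw [this, Real.rpow_natCast]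
  exact div_self (by positivity)

lemma integrable_noiseDensity (hN : IsNorm N) (hr : 0 < r) {t : ℝ} (ht : 0 < t) :
    Integrable (noiseDensity N r t) :=
  (hN.integrable_exp_mul hr (by positivity)).div_const _

lemma isProbabilityMeasure_noiseLaw (hN : IsNorm N) (hr : 0 < r) {t : ℝ} (ht : 0 < t) :
    IsProbabilityMeasure (noiseLaw N r t) := by
  refine ⟨?_⟩
  rw [noiseLaw, withDensity_apply _ MeasurableSet.univ, Measure.restrict_univ,
    ← ofReal_integral_eq_lintegral_ofReal (integrable_noiseDensity hN hr ht)
      (Eventually.of_forall fun z => (noiseDensity_pos hN hr ht z).le),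
    integral_noiseDensity hN hr ht, ENNReal.ofReal_one]

lemma noiseDensity_smul (hN : IsNorm N) {t : ℝ} (ht : 0 < t) (z : Fin d → ℝ) :
    noiseDensity N r t (t • z) = noiseDensity N r 1 z / t ^ d := by
  unfold noiseDensity
  rw [hN.rpow_smul ht.le, ← mul_assoc, ← Real.rpow_add ht]
  simp [div_div]

lemma map_smul_noiseLaw (hN : IsNorm N) {t : ℝ} (ht : 0 < t) :
    (noiseLaw N r 1).map (fun z => t • z) = noiseLaw N r t := by
  have hm := measurable_noiseDensity (r := r) (t := t) hN
  have hm1 := measurable_noiseDensity (r := r) (t := 1) hN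
  ext s hs
  rw [Measure.map_apply (by fun_prop) hs, noiseLaw, noiseLaw,
    withDensity_apply _ (measurable_const_smul t hs), withDensity_apply _ hs,
    ← lintegral_indicator (measurable_const_smul t hs), ← lintegral_indicator hs]
  have hms : Measurable (s.indicator fun z => ENNReal.ofReal (noiseDensity N r t z)) :=
    Measurable.indicator (by fun_prop) hs
  have h : ∫⁻ z, s.indicator (fun z => ENNReal.ofReal (noiseDensity N r t z)) (t • z) =
      ENNReal.ofReal (t ^ d)⁻¹ *
        ∫⁻ z, s.indicator (fun z => ENNReal.ofReal (noiseDensity N r t z)) z := by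
    have h0 : (0 : ℝ) < (t ^ d)⁻¹ := by positivity
    rw [← lintegral_map (g := fun z => t • z) hms (measurable_const_smul t),
      Measure.map_addHaar_smul volume ht.ne', lintegral_smul_measure, smul_eq_mul,
      Module.finrank_fin_fun, abs_of_pos h0]
  have h2 : ∀ z, ((fun z => t • z) ⁻¹' s).indicator
      (fun z => ENNReal.ofReal (noiseDensity N r 1 z)) z = ENNReal.ofReal (t ^ d) *
      s.indicator (fun z => ENNReal.ofReal (noiseDensity N r t z)) (t • z) := fun z => by
    by_cases hz : t • z ∈ s
    · rw [indicator_of_mem hz, indicator_of_mem (by simpa using hz),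
        ← ENNReal.ofReal_mul (by positivity), noiseDensity_smul hN ht]
      congr 1
      field_simp
    · rw [indicator_of_notMem hz, indicator_of_notMem (by simpa using hz), mul_zero]
  simp_rw [h2]
  rw [lintegral_const_mul' _ _ ENNReal.ofReal_ne_top, h,
    ← mul_assoc, ← ENNReal.ofReal_mul (by positivity), mul_inv_cancel₀ (by positivity),
    ENNReal.ofReal_one, one_mul]

lemma integral_noiseLaw (hN : IsNorm N) (hr : 0 < r) {t : ℝ} (ht : 0 < t)
    (g : (Fin d → ℝ) → ℝ) :
    ∫ z, g z ∂(noiseLaw N r t) = ∫ z, noiseDensity N r t z * g z := by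
  have hm := measurable_noiseDensity (r := r) (t := t) hN
  rw [noiseLaw, integral_withDensity_eq_integral_toReal_smul₀ (by fun_prop) (by simp)]
  simp [ENNReal.toReal_ofReal (noiseDensity_pos hN hr ht _).le]

lemma integrable_noiseLaw_iff (hN : IsNorm N) (hr : 0 < r) {t : ℝ} (ht : 0 < t)
    (g : (Fin d → ℝ) → ℝ) :
    Integrable g (noiseLaw N r t) ↔ Integrable fun z => noiseDensity N r t z * g z := by
  have hm := measurable_noiseDensity (r := r) (t := t) hN
  rw [noiseLaw, integrable_withDensity_iff_integrable_smul₀' (by fun_prop) (by simp)]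
  simp [ENNReal.toReal_ofReal (noiseDensity_pos hN hr ht _).le]

lemma integrable_rpow_noiseLaw_one (hN : IsNorm N) (hr : 0 < r) :
    Integrable (fun z => N z ^ r) (noiseLaw N r 1) := by
  rw [integrable_noiseLaw_iff hN hr one_pos]
  refine ((hN.integrable_rpow_mul_exp hr).div_const
    (IsNorm.ballVol N * Real.Gamma (1 + d / r))).congr (Eventually.of_forall fun z => ?_)
  simp [noiseDensity]
  ring

lemma integral_rpow_noiseLaw_one (hN : IsNorm N) (hr : 0 < r) :
    ∫ z, N z ^ r ∂(noiseLaw N r 1) = d / r := by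
  rw [integral_noiseLaw hN hr one_pos]
  have h : ∀ z, noiseDensity N r 1 z * N z ^ r =
      N z ^ r * Real.exp (-(N z) ^ r) / (IsNorm.ballVol N * Real.Gamma (1 + d / r)) := fun z => by
    simp [noiseDensity]
    ring
  simp_rw [h]
  rw [integral_div, hN.integral_rpow_mul_exp hr, mul_div_assoc, div_self, mul_one]
  exact (mul_pos hN.ballVol_pos (IsNorm.gamma_pos d hr)).ne'

lemma integrable_rpow_noiseLaw (hN : IsNorm N) (hr : 0 < r) {t : ℝ} (ht : 0 < t) :
    Integrable (fun z => N z ^ r) (noiseLaw N r t) := by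
  have := hN.measurable
  rw [← map_smul_noiseLaw hN ht, integrable_map_measure
    (Measurable.aestronglyMeasurable (by fun_prop)) (by fun_prop)]
  simp only [Function.comp_def, hN.rpow_smul ht.le]
  exact (integrable_rpow_noiseLaw_one hN hr).const_mul _

lemma integral_rpow_noiseLaw (hN : IsNorm N) (hr : 0 < r) {t : ℝ} (ht : 0 < t) :
    ∫ z, N z ^ r ∂(noiseLaw N r t) = d / r * t ^ r := by
  have := hN.measurable
  rw [← map_smul_noiseLaw hN ht, integral_map (by fun_prop)
    (Measurable.aestronglyMeasurable (by fun_prop))]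
  simp only [hN.rpow_smul ht.le]
  rw [integral_const_mul, integral_rpow_noiseLaw_one hN hr, mul_comm]

lemma log_noiseDensity (hN : IsNorm N) (hr : 0 < r) {t : ℝ} (ht : 0 < t) (z : Fin d → ℝ) :
    Real.log (noiseDensity N r t z) =
      -(t ^ (-r)) * N z ^ r -
        (Real.log (IsNorm.ballVol N * Real.Gamma (1 + d / r)) + d * Real.log t) := by
  have h1 := hN.ballVol_pos
  have h2 := IsNorm.gamma_pos d hr
  rw [noiseDensity, Real.log_div (Real.exp_pos _).ne' (by positivity), Real.log_exp,
    Real.log_mul (x := _ * _) (by positivity) (by positivity), Real.log_pow]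
  ring

lemma integrable_log_noiseDensity (hN : IsNorm N) (hr : 0 < r) {t : ℝ} (ht : 0 < t) :
    Integrable (fun z => Real.log (noiseDensity N r t z)) (noiseLaw N r t) := by
  have := isProbabilityMeasure_noiseLaw hN hr ht
  simp_rw [log_noiseDensity hN hr ht]
  exact ((integrable_rpow_noiseLaw hN hr ht).const_mul _).sub (integrable_const _)

lemma integral_log_noiseDensity (hN : IsNorm N) (hr : 0 < r) {t : ℝ} (ht : 0 < t) :
    ∫ z, Real.log (noiseDensity N r t z) ∂(noiseLaw N r t) =
      -(d / r) - Real.log (IsNorm.ballVol N * Real.Gamma (1 + d / r)) - d * Real.log t := by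
  have := isProbabilityMeasure_noiseLaw hN hr ht
  simp_rw [log_noiseDensity hN hr ht]
  rw [integral_sub ((integrable_rpow_noiseLaw hN hr ht).const_mul _) (integrable_const _),
    integral_const_mul, integral_rpow_noiseLaw hN hr ht]
  simp only [integral_const, probReal_univ, smul_eq_mul, one_mul]
  have h : t ^ (-r) * t ^ r = 1 := by rw [← Real.rpow_add ht]; simp
  linear_combination (-(d / r : ℝ)) * h

lemma lintegral_distortion_shiftKernel [IsProbabilityMeasure μ] (hN : IsNorm N) (hr : 0 < r)
    {t : ℝ} (ht : 0 < t) :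
    ∫⁻ p, ENNReal.ofReal (N (p.1 - p.2) ^ r) ∂(μ.compProd (shiftKernel (noiseLaw N r t))) =
      ENNReal.ofReal (d / r * t ^ r) := by
  have := isProbabilityMeasure_noiseLaw hN hr ht
  have hm := hN.measurable
  rw [compProd_shiftKernel, lintegral_map (by fun_prop) (by fun_prop)]
  simp only [sub_add_cancel_left, hN.neg]
  rw [lintegral_prod _ (by fun_prop)]
  simp only [lintegral_const, measure_univ, mul_one]
  rw [← ofReal_integral_eq_lintegral_ofReal (integrable_rpow_noiseLaw hN hr ht)
    (Eventually.of_forall fun z => hN.rpow_nonneg r z), integral_rpow_noiseLaw hN hr ht]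

end GammaNoise

section RateDistortionUpperBound

variable {d : ℕ} {N : (Fin d → ℝ) → ℝ} {r : ℝ} {μ : Measure (Fin d → ℝ)} {f : (Fin d → ℝ) → ℝ}

lemma IsReference.integrable_bound_prod [IsProbabilityMeasure μ] (hN : IsNorm N) (hr : 0 < r)
    {b : (Fin d → ℝ) → ℝ} (hb : Integrable b μ) (C : ℝ) :
    Integrable (fun p : (Fin d → ℝ) × (Fin d → ℝ) => b p.1 + C * N p.2 ^ r)
      (μ.prod (noiseLaw N r 1)) := by
  have := isProbabilityMeasure_noiseLaw hN hr one_pos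
  exact (hb.comp_fst _).add (((integrable_rpow_noiseLaw_one hN hr).const_mul C).comp_snd _)

lemma ae_prod_of_ae_fst {α β : Type*} [MeasurableSpace α] [MeasurableSpace β] {μ : Measure α}
    [SFinite μ] {ν : Measure β} [SFinite ν] {p : α × β → Prop} (h : ∀ᵐ x ∂μ, ∀ y, p (x, y)) :
    ∀ᵐ q ∂(μ.prod ν), p q := by
  filter_upwards [Measure.quasiMeasurePreserving_fst.ae h] with q hq using hq q.2

lemma IsReference.ae_abs_log_le [IsProbabilityMeasure μ] {v b : (Fin d → ℝ) → ℝ}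
    (hN : IsNorm N) (hr : 0 < r) {C t : ℝ} (hC : 0 ≤ C) (ht0 : 0 ≤ t) (ht1 : t ≤ 1)
    (hb : ∀ᵐ x ∂μ, ∀ z, |Real.log (v (x + z))| ≤ b x + C * N z ^ r) :
    ∀ᵐ p ∂(μ.prod (noiseLaw N r 1)), ‖Real.log (v (p.1 + t • p.2))‖ ≤ b p.1 + C * N p.2 ^ r := by
  have := isProbabilityMeasure_noiseLaw (r := r) hN hr one_pos
  refine ae_prod_of_ae_fst ?_
  filter_upwards [hb] with x hx z
  refine (hx (t • z)).trans ?_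
  rw [hN.rpow_smul ht0]
  have h1 : t ^ r ≤ 1 := Real.rpow_le_one ht0 ht1 hr.le
  have h2 := hN.rpow_nonneg r z
  have h3 : t ^ r * N z ^ r ≤ N z ^ r := mul_le_of_le_one_left h2 h1
  gcongr

lemma IsReference.tendsto_integral [IsProbabilityMeasure μ] {v : (Fin d → ℝ) → ℝ}
    (hv : IsReference N r μ v) (hN : IsNorm N) (hr : 0 < r) :
    Tendsto (fun t : ℝ => ∫ p, Real.log (v (p.1 + t • p.2)) ∂(μ.prod (noiseLaw N r 1)))
      (𝓝[>] 0) (𝓝 (∫ x, Real.log (v x) ∂μ)) := by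
  have := isProbabilityMeasure_noiseLaw (r := r) hN hr one_pos
  obtain ⟨b, C, hC, hb, h⟩ := hv.exists_abs_log_le hN
  have hvm := hv.continuous.measurable
  have h0 : ∫ x, Real.log (v x) ∂μ =
      ∫ p, Real.log (v p.1) ∂(μ.prod (noiseLaw N r 1)) := by
    rw [integral_fun_fst (μ := μ) (ν := noiseLaw N r 1) fun x => Real.log (v x)]
    simp
  rw [h0]
  refine tendsto_integral_filter_of_dominated_convergence _ ?_ ?_
    (IsReference.integrable_bound_prod hN hr hb C) ?_
  · exact Eventually.of_forall fun t => Measurable.aestronglyMeasurable (by fun_prop)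
  · filter_upwards [Ioc_mem_nhdsGT one_pos] with t ht
    exact IsReference.ae_abs_log_le hN hr hC ht.1.le ht.2 h
  · refine Eventually.of_forall fun p => ?_
    have hc : Continuous fun t : ℝ => Real.log (v (p.1 + t • p.2)) :=
      (hv.continuous.comp (by fun_prop)).log fun t => (hv.pos _).ne'
    have := hc.tendsto 0
    simp only [zero_smul, add_zero] at this
    exact this.mono_left nhdsWithin_le_nhds

lemma integral_prod_noiseLaw [IsProbabilityMeasure μ] (hN : IsNorm N) (hr : 0 < r)
    {t : ℝ} (ht : 0 < t) {g : (Fin d → ℝ) → ℝ} (hg : Measurable g) :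
    ∫ p, g (p.1 + p.2) ∂(μ.prod (noiseLaw N r t)) =
      ∫ p, g (p.1 + t • p.2) ∂(μ.prod (noiseLaw N r 1)) := by
  have := isProbabilityMeasure_noiseLaw (r := r) hN hr one_pos
  have h := Measure.map_prod_map μ (noiseLaw N r 1) measurable_id (measurable_const_smul t)
  rw [Measure.map_id, map_smul_noiseLaw hN ht] at h
  rw [h, integral_map (by fun_prop) (Measurable.aestronglyMeasurable (by fun_prop))]
  rfl

lemma integrable_prod_noiseLaw_iff [IsProbabilityMeasure μ] (hN : IsNorm N) (hr : 0 < r)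
    {t : ℝ} (ht : 0 < t) {g : (Fin d → ℝ) → ℝ} (hg : Measurable g) :
    Integrable (fun p : (Fin d → ℝ) × (Fin d → ℝ) => g (p.1 + p.2)) (μ.prod (noiseLaw N r t)) ↔
      Integrable (fun p : (Fin d → ℝ) × (Fin d → ℝ) => g (p.1 + t • p.2))
        (μ.prod (noiseLaw N r 1)) := by
  have := isProbabilityMeasure_noiseLaw (r := r) hN hr one_pos
  have h := Measure.map_prod_map μ (noiseLaw N r 1) measurable_id (measurable_const_smul t)
  rw [Measure.map_id, map_smul_noiseLaw hN ht] at h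
  rw [h, integrable_map_measure (Measurable.aestronglyMeasurable (by fun_prop)) (by fun_prop)]
  rfl

lemma IsReference.RDfun_le [IsProbabilityMeasure μ] {v : (Fin d → ℝ) → ℝ}
    (hv : IsReference N r μ v) (hN : IsNorm N) (hr : 0 < r) {ε : ℝ} (hε : 0 < ε)
    (hv1 : ∫ x, v x ≤ 1 + ε) {t : ℝ} (ht : 0 < t) (ht1 : t ≤ 1) :
    RDfun μ N r (d / r * t ^ r) ≤ ENNReal.ofReal
      (-(d / r) - Real.log (IsNorm.ballVol N * Real.Gamma (1 + d / r)) - d * Real.log t + ε -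
        ∫ p, Real.log (v (p.1 + t • p.2)) ∂(μ.prod (noiseLaw N r 1))) := by
  have hp1 := isProbabilityMeasure_noiseLaw (r := r) hN hr one_pos
  have hpt := isProbabilityMeasure_noiseLaw (r := r) hN hr ht
  have hvm := hv.continuous.measurable
  obtain ⟨b, C, hC, hb, h⟩ := hv.exists_abs_log_le hN
  have hint : Integrable (fun p : (Fin d → ℝ) × (Fin d → ℝ) => Real.log (v (p.1 + t • p.2)))
      (μ.prod (noiseLaw N r 1)) :=
    (IsReference.integrable_bound_prod hN hr hb C).mono'
      (Measurable.aestronglyMeasurable (by fun_prop))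
      (IsReference.ae_abs_log_le hN hr hC ht.le ht1 h)
  have hker : ProbabilityTheory.IsMarkovKernel (shiftKernel (noiseLaw N r t)) := inferInstance
  have hRD : RDfun μ N r (d / r * t ^ r) ≤
      mutualInfo (μ.compProd (shiftKernel (noiseLaw N r t))) :=
    iInf_le_of_le _ (iInf_le_of_le hker
      (iInf_le_of_le (lintegral_distortion_shiftKernel hN hr ht).le le_rfl))
  refine hRD.trans ?_
  have hlw : ∀ x, Real.log (v x / (1 + ε)) = Real.log (v x) - Real.log (1 + ε) := fun x =>
    Real.log_div (hv.pos x).ne' (by positivity)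
  have hint' := (integrable_prod_noiseLaw_iff hN hr ht (g := fun x => Real.log (v x))
    (by fun_prop)).2 hint
  have hM : ∀ z, noiseDensity N r t z ≤
      1 / (IsNorm.ballVol N * Real.Gamma (1 + d / r) * t ^ d) := fun z => by
    have h1 := hN.ballVol_pos
    have h2 := IsNorm.gamma_pos d hr
    have h3 := hN.rpow_nonneg r z
    unfold noiseDensity
    gcongr
    rw [Real.exp_le_one_iff, neg_nonpos]
    positivity
  refine (mutualInfo_shiftKernel_le (μ := μ) (ζ := noiseLaw N r t) (measurable_noiseDensity hN)
    (noiseDensity_pos hN hr ht) hM rfl (integrable_log_noiseDensity hN hr ht)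
    (w := fun x => v x / (1 + ε)) (by fun_prop) (fun x => div_pos (hv.pos x) (by positivity))
    (hv.integrable.div_const _) ?_ ?_).trans (ENNReal.ofReal_le_ofReal ?_)
  · rw [integral_div, div_le_one (by positivity)]
    exact hv1
  · simp_rw [hlw]
    exact hint'.sub (integrable_const _)
  · simp_rw [hlw]
    rw [integral_sub hint' (integrable_const _), integral_log_noiseDensity hN hr ht,
      integral_prod_noiseLaw hN hr ht (g := fun x => Real.log (v x)) (by fun_prop)]
    simp only [integral_const, probReal_univ, smul_eq_mul, one_mul]
    have := Real.log_le_sub_one_of_pos (by positivity : 0 < 1 + ε)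
    linarith

/-- Asymptotic upper bound matching the Shannon lower bound. -/
lemma IsSource.eventually_RDfun_le [IsProbabilityMeasure μ] (h : IsSource μ f) (hN : IsNorm N)
    (hd : 0 < d) (hr : 0 < r)
    (hfloor : Summable fun k : Fin d → ℤ => Real.negMulLog (floorProb μ k))
    {ε : ℝ} (hε : 0 < ε) :
    ∀ᶠ D in 𝓝[>] (0 : ℝ), RDfun μ N r D ≤ ENNReal.ofReal
      (-∫ x, Real.log (f x) ∂μ + d / r * Real.log (d / (r * D)) - d / r -
        Real.log (IsNorm.ballVol N * Real.Gamma (1 + d / r)) + ε) := by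
  have hd' : (0 : ℝ) < d := by exact_mod_cast hd
  obtain ⟨v, hv, hv1, hvf⟩ := h.exists_reference hN hr hfloor (show 0 < ε / 3 by positivity)
  have hev : ∀ᶠ t in 𝓝[>] (0 : ℝ), t ≤ 1 ∧ ∫ x, Real.log (v x) ∂μ - ε / 3 ≤
      ∫ p, Real.log (v (p.1 + t • p.2)) ∂(μ.prod (noiseLaw N r 1)) := by
    filter_upwards [Ioc_mem_nhdsGT one_pos, (hv.tendsto_integral hN hr).eventually
      (Ici_mem_nhds (show ∫ x, Real.log (v x) ∂μ - ε / 3 < _ by linarith))] with t ht ht2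
    exact ⟨ht.2, ht2⟩
  have htend : Tendsto (fun D : ℝ => (r / d * D) ^ (1 / r)) (𝓝[>] 0) (𝓝[>] 0) := by
    refine tendsto_nhdsWithin_iff.2 ⟨?_, ?_⟩
    · have hc : Continuous fun D : ℝ => (r / d * D) ^ (1 / r) :=
        (continuous_const.mul continuous_id).rpow_const fun _ => Or.inr (by positivity)
      have := hc.tendsto 0
      simp only [mul_zero, Real.zero_rpow (one_div_pos.2 hr).ne'] at this
      exact this.mono_left nhdsWithin_le_nhds
    · filter_upwards [self_mem_nhdsWithin] with D hD
      have hD' : (0 : ℝ) < D := hD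
      exact mem_Ioi.2 (by positivity)
  filter_upwards [htend.eventually hev, self_mem_nhdsWithin] with D hD hD0
  have hD0' : (0 : ℝ) < D := hD0
  have hbase : 0 < r / d * D := by positivity
  have hpow : d / r * ((r / d * D) ^ (1 / r)) ^ r = D := by
    rw [← Real.rpow_mul hbase.le, one_div_mul_cancel hr.ne', Real.rpow_one]
    field_simp
  have hlog : d * Real.log ((r / d * D) ^ (1 / r)) = -(d / r * Real.log (d / (r * D))) := by
    rw [Real.log_rpow hbase]
    have : r / d * D = (d / (r * D))⁻¹ := by field_simp
    rw [this, Real.log_inv]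
    ring
  have key := hv.RDfun_le hN hr (show 0 < ε / 3 by positivity) hv1
    (show 0 < (r / d * D) ^ (1 / r) by positivity) hD.1
  rw [hpow, hlog] at key
  refine key.trans (ENNReal.ofReal_le_ofReal ?_)
  linarith [hD.2]

end RateDistortionUpperBound

section CellBounds

variable {d : ℕ} {N : (Fin d → ℝ) → ℝ} {r : ℝ} {μ : Measure (Fin d → ℝ)} {f : (Fin d → ℝ) → ℝ}

lemma IsNorm.integrable_truncated (hN : IsNorm N) (hr : 0 < r) {ρ : ℝ} (hρ : 0 < ρ) :
    Integrable fun x => max (ρ ^ r - N x ^ r) 0 := by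
  have hm := hN.measurable
  refine ((hN.integrable_exp_mul hr (s := (ρ ^ r)⁻¹) (by positivity)).const_mul (ρ ^ r)).mono'
    (Measurable.aestronglyMeasurable (by fun_prop)) (Eventually.of_forall fun x => ?_)
  have hρr : 0 < ρ ^ r := by positivity
  rw [Real.norm_of_nonneg (le_max_right _ _)]
  refine max_le ?_ (by positivity)
  have h1 := Real.add_one_le_exp (-((ρ ^ r)⁻¹ * N x ^ r))
  calc ρ ^ r - N x ^ r = ρ ^ r * (-((ρ ^ r)⁻¹ * N x ^ r) + 1) := by field_simp; ring
    _ ≤ _ := by gcongr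

lemma IsNorm.integral_truncated (hN : IsNorm N) (hd : 0 < d) (hr : 0 < r) {ρ : ℝ} (hρ : 0 < ρ) :
    ∫ x, max (ρ ^ r - N x ^ r) 0 = ballVol N * ρ ^ d * ρ ^ r * (r / (d + r)) := by
  have hV := hN.ballVol_pos
  have hρr : 0 < ρ ^ r := by positivity
  rw [(hN.integrable_truncated hr hρ).integral_eq_integral_Ioc_meas_le (M := ρ ^ r)
    (Eventually.of_forall fun x => le_max_right _ _)
    (Eventually.of_forall fun x => max_le (by linarith [hN.rpow_nonneg r x]) hρr.le),
    ← intervalIntegral.integral_of_le hρr.le]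
  have h1 : ∫ t in (0 : ℝ)..ρ ^ r, volume.real {x | t ≤ max (ρ ^ r - N x ^ r) 0} =
      ∫ t in (0 : ℝ)..ρ ^ r, ballVol N * (ρ ^ r - t) ^ ((d : ℝ) / r) := by
    refine intervalIntegral.integral_congr_uIoo fun t ht => ?_
    rw [uIoo_of_le hρr.le] at ht
    have h0 : 0 < ρ ^ r - t := by linarith [ht.2]
    have hset : {x | t ≤ max (ρ ^ r - N x ^ r) 0} = {x | N (x - 0) ≤ (ρ ^ r - t) ^ (1 / r)} := by
      ext x
      simp only [mem_ofPred_eq, sub_zero, le_max_iff, not_le.2 ht.1, or_false]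
      rw [one_div, Real.le_rpow_inv_iff_of_pos (hN.nonneg x) h0.le hr]
      constructor <;> intro h <;> linarith
    rw [hset, measureReal_def, hN.volume_real_le hd 0 (by positivity),
      ENNReal.toReal_ofReal (by positivity), ← Real.rpow_natCast, ← Real.rpow_mul h0.le]
    congr 2
    ring
  rw [h1, intervalIntegral.integral_const_mul,
    intervalIntegral.integral_comp_sub_left (fun t => t ^ ((d : ℝ) / r)), sub_self, sub_zero,
    integral_rpow (Or.inl (by have : 0 ≤ (d : ℝ) / r := by positivity
                              linarith)), Real.zero_rpow (by positivity), sub_zero,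
    Real.rpow_add hρr, Real.rpow_one, ← Real.rpow_mul hρ.le, mul_div_cancel₀ _ hr.ne',
    Real.rpow_natCast]
  field_simp

lemma IsSource.integrableOn_iff (h : IsSource μ f) (g : (Fin d → ℝ) → ℝ) {s : Set (Fin d → ℝ)}
    (hs : MeasurableSet s) : IntegrableOn g s μ ↔ IntegrableOn (fun x => f x * g x) s := by
  have := h.measurable
  rw [IntegrableOn, h.eq, restrict_withDensity hs,
    integrable_withDensity_iff_integrable_smul₀' (by fun_prop) (by simp)]
  simp [ENNReal.toReal_ofReal (h.nonneg _), IntegrableOn]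

/-- Gibbs' inequality on a set. -/
lemma IsSource.gibbs [IsProbabilityMeasure μ] (h : IsSource μ f) {B : Set (Fin d → ℝ)}
    (hB : MeasurableSet B) {g : (Fin d → ℝ) → ℝ} (hg : IntegrableOn g B μ)
    {Z : ℝ} (hZ : 0 < Z) (hgi : Integrable fun x => Real.exp (-g x))
    (hgZ : ∫ x, Real.exp (-g x) ≤ Z) :
    μ.real B * -Real.log Z ≤
      Real.negMulLog (μ.real B) + ∫ x in B, Real.log (f x) ∂μ + ∫ x in B, g x ∂μ := by
  rcases (measureReal_nonneg : 0 ≤ μ.real B).eq_or_lt with hb | hb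
  · have h0 : μ.restrict B = 0 := by
      rw [Measure.restrict_eq_zero]
      exact (measureReal_eq_zero_iff).1 hb.symm
    simp [h0, ← hb]
  set b := μ.real B with hbdef
  have hi1 : IntegrableOn (fun x => f x * g x) B := (h.integrableOn_iff g hB).1 hg
  have hi2 : IntegrableOn (fun x => f x * Real.log (f x)) B := h.ent.integrableOn
  have hi3 : IntegrableOn f B := h.integrable.integrableOn
  have hi4 : IntegrableOn (fun x => Real.exp (-g x)) B := hgi.integrableOn
  have hfb : ∫ x in B, f x = b := (h.measureReal_eq hB).symm
  have key : ∀ x, (Real.log b - Real.log Z + 1) * f x - b / Z * Real.exp (-g x) ≤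
      f x * Real.log (f x) + f x * g x := fun x => by
    have h1 := mul_log_add_sub_le (h.nonneg x)
      (show 0 < b / Z * Real.exp (-g x) by positivity)
    rw [Real.log_mul (by positivity) (Real.exp_pos _).ne', Real.log_exp,
      Real.log_div hb.ne' hZ.ne'] at h1
    linarith
  have h2 : ∫ x in B, ((Real.log b - Real.log Z + 1) * f x - b / Z * Real.exp (-g x)) ≤
      ∫ x in B, (f x * Real.log (f x) + f x * g x) :=
    integral_mono ((hi3.const_mul _).sub (hi4.const_mul _)) (hi2.add hi1) key
  rw [integral_sub (hi3.const_mul _) (hi4.const_mul _), integral_const_mul, integral_const_mul,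
    hfb, integral_add hi2 hi1] at h2
  have h4 : ∫ x in B, Real.exp (-g x) ≤ Z :=
    (setIntegral_le_integral hgi (Eventually.of_forall fun x => (Real.exp_pos _).le)).trans hgZ
  have h5 : b / Z * ∫ x in B, Real.exp (-g x) ≤ b := by
    calc b / Z * ∫ x in B, Real.exp (-g x) ≤ b / Z * Z := by gcongr
      _ = b := by field_simp
  rw [h.setIntegral_eq _ hB, h.setIntegral_eq _ hB, Real.negMulLog]
  linarith

/-- Lower bound for the contribution of a set on which the density is almost constant. -/
lemma IsSource.le_of_oscillation [IsProbabilityMeasure μ] (h : IsSource μ f) (hN : IsNorm N)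
    (hd : 0 < d) (hr : 0 < r) {A : Set (Fin d → ℝ)} (hA : MeasurableSet A) (c : Fin d → ℝ)
    (hg : IntegrableOn (fun x => N (x - c) ^ r) A μ) {lam s : ℝ} (hl : 1 ≤ lam) (hs : 0 < s)
    (hf : ∀ x ∈ A, 0 < f x) (hosc : ∀ x ∈ A, ∀ y ∈ A, f x ≤ lam * f y) :
    μ.real A * (d / r * (1 + Real.log (s * r / (d + r))) - Real.log (IsNorm.ballVol N) -
        2 * Real.log lam) ≤
      Real.negMulLog (μ.real A) + ∫ x in A, Real.log (f x) ∂μ +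
        s * ∫ x in A, N (x - c) ^ r ∂μ := by
  rcases (measureReal_nonneg : 0 ≤ μ.real A).eq_or_lt with ha | ha
  · have h0 : μ.restrict A = 0 := by
      rw [Measure.restrict_eq_zero]
      exact (measureReal_eq_zero_iff).1 ha.symm
    simp [h0, ← ha]
  set a := μ.real A with hadef
  have hd' : (0 : ℝ) < d := by exact_mod_cast hd
  have hV := hN.ballVol_pos
  obtain ⟨x₀, hx₀⟩ : A.Nonempty := by
    rw [nonempty_iff_ne_empty]
    rintro rfl
    simp [hadef] at ha
  set m := lam * f x₀ with hm
  have hl0 : 0 < lam := by linarith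
  have hm0 : 0 < m := mul_pos hl0 (hf x₀ hx₀)
  set ρ := (a / (m * IsNorm.ballVol N)) ^ (1 / (d : ℝ)) with hρdef
  have hρ : 0 < ρ := by positivity
  have hρd : ρ ^ d = a / (m * IsNorm.ballVol N) := by
    rw [hρdef, ← Real.rpow_natCast, ← Real.rpow_mul (by positivity), one_div_mul_cancel hd'.ne',
      Real.rpow_one]
  have hlogA : a * (Real.log m - 2 * Real.log lam) ≤ ∫ x in A, Real.log (f x) ∂μ := by
    have h1 : ∫ x in A, (Real.log m - 2 * Real.log lam) ∂μ ≤ ∫ x in A, Real.log (f x) ∂μ := by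
      refine setIntegral_mono_on (integrable_const _).integrableOn
        h.integrable_log.integrableOn hA fun x hx => ?_
      have h2 := Real.log_le_log (hf x₀ hx₀) (hosc x₀ hx₀ x hx)
      rw [Real.log_mul hl0.ne' (hf x hx).ne'] at h2
      rw [hm, Real.log_mul hl0.ne' (hf x₀ hx₀).ne']
      linarith
    simpa using h1
  have hfa : ∫ x in A, f x = a := (h.measureReal_eq hA).symm
  have hgA : a * ρ ^ r * (d / (d + r)) ≤ ∫ x in A, N (x - c) ^ r ∂μ := by
    rw [h.setIntegral_eq _ hA]
    have hti : Integrable fun x => max (ρ ^ r - N (x - c) ^ r) 0 :=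
      (hN.integrable_truncated hr hρ).comp_sub_right c
    have h1 : ∫ x in A, (ρ ^ r * f x - m * max (ρ ^ r - N (x - c) ^ r) 0) ≤
        ∫ x in A, f x * N (x - c) ^ r := by
      refine setIntegral_mono_on ((h.integrable.const_mul _).sub (hti.const_mul _)).integrableOn
        ((h.integrableOn_iff _ hA).1 hg) hA fun x hx => ?_
      have h2 : f x * (ρ ^ r - N (x - c) ^ r) ≤ m * max (ρ ^ r - N (x - c) ^ r) 0 :=
        (mul_le_mul_of_nonneg_left (le_max_left _ _) (h.nonneg x)).trans
          (mul_le_mul_of_nonneg_right (hosc x hx x₀ hx₀) (le_max_right _ _))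
      linarith
    rw [integral_sub (h.integrable.const_mul _).integrableOn (hti.const_mul _).integrableOn,
      integral_const_mul, integral_const_mul, hfa] at h1
    have h3 : ∫ x in A, max (ρ ^ r - N (x - c) ^ r) 0 ≤
        IsNorm.ballVol N * ρ ^ d * ρ ^ r * (r / (d + r)) := by
      refine (setIntegral_le_integral hti (Eventually.of_forall fun x => le_max_right _ _)).trans ?_
      rw [integral_sub_right_eq_self (fun x => max (ρ ^ r - N x ^ r) 0) c,
        hN.integral_truncated hd hr hρ]
    have h4 : m * (IsNorm.ballVol N * ρ ^ d * ρ ^ r * (r / (d + r))) =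
        a * ρ ^ r * (r / (d + r)) := by
      rw [hρd]
      field_simp
    have h5 := mul_le_mul_of_nonneg_left h3 hm0.le
    rw [h4] at h5
    have h6 : a * ρ ^ r * (d / (d + r)) = ρ ^ r * a - a * ρ ^ r * (r / (d + r)) := by
      field_simp
      ring
    linarith
  have hlogm : Real.log m = Real.log a - Real.log (IsNorm.ballVol N) - d * Real.log ρ := by
    have h1 : Real.log a = Real.log (m * IsNorm.ballVol N * ρ ^ d) := by
      rw [hρd]
      congr 1
      field_simp
    rw [Real.log_mul (by positivity) (by positivity), Real.log_mul hm0.ne' hV.ne',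
      Real.log_pow] at h1
    linarith
  have hopt : d / r * (1 + Real.log (s * r / (d + r))) ≤
      -(d * Real.log ρ) + s * (ρ ^ r * (d / (d + r))) := by
    have h1 := Real.log_le_sub_one_of_pos (show 0 < s * r / (d + r) * ρ ^ r by positivity)
    rw [Real.log_mul (by positivity) (by positivity), Real.log_rpow hρ] at h1
    have h2 := mul_le_mul_of_nonneg_left h1 (show 0 ≤ d / r by positivity)
    have h3 : d / r * (s * r / (d + r) * ρ ^ r - 1) = s * (ρ ^ r * (d / (d + r))) - d / r := by
      field_simp
    have h4 : d / r * (r * Real.log ρ) = d * Real.log ρ := by field_simp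
    rw [h3, mul_add, h4] at h2
    linarith
  have h5 := mul_le_mul_of_nonneg_left hopt ha.le
  have h6 := mul_le_mul_of_nonneg_left hgA hs.le
  rw [hlogm] at hlogA
  rw [Real.negMulLog]
  nlinarith

lemma le_negMulLog_add {a b η : ℝ} (ha : 0 ≤ a) (hb : 0 ≤ b) (hη : 0 < η) (hη1 : η < 1) :
    Real.negMulLog a + Real.negMulLog b + a * Real.log (1 - η) + b * Real.log η ≤
      Real.negMulLog (a + b) := by
  rcases (add_nonneg ha hb).eq_or_lt with hp | hp
  · have ha0 : a = 0 := by linarith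
    have hb0 : b = 0 := by linarith
    simp [ha0, hb0]
  have hη' : 0 < 1 - η := by linarith
  have h1 := mul_log_add_sub_le ha (mul_pos hη' hp)
  have h2 := mul_log_add_sub_le hb (mul_pos hη hp)
  rw [Real.log_mul (by positivity) hp.ne'] at h1 h2
  simp only [Real.negMulLog]
  linarith

end CellBounds

section QuantizerLowerBound

variable {d : ℕ} {N : (Fin d → ℝ) → ℝ} {r : ℝ} {μ : Measure (Fin d → ℝ)} {f : (Fin d → ℝ) → ℝ}

lemma ENNReal.summable_of_tsum_ofReal_ne_top {ι : Type*} {x : ι → ℝ} (hx : ∀ i, 0 ≤ x i)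
    (h : ∑' i, ENNReal.ofReal (x i) ≠ ∞) :
    Summable x ∧ ∑' i, ENNReal.ofReal (x i) = ENNReal.ofReal (∑' i, x i) := by
  have hs : Summable x := by
    simpa [ENNReal.toReal_ofReal (hx _)] using ENNReal.summable_toReal h
  exact ⟨hs, (ENNReal.ofReal_tsum_of_nonneg hx hs).symm⟩

namespace Quantizer

lemma negMulLog_nonneg [IsProbabilityMeasure μ] (q : Quantizer (Fin d → ℝ)) (i : ℤ) :
    0 ≤ Real.negMulLog (μ.real (q.S i)) :=
  Real.negMulLog_nonneg measureReal_nonneg measureReal_le_one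

lemma summable_negMulLog [IsProbabilityMeasure μ] (q : Quantizer (Fin d → ℝ))
    (h : q.entropy μ ≠ ∞) :
    Summable (fun i => Real.negMulLog (μ.real (q.S i))) ∧
      q.entropy μ = ENNReal.ofReal (∑' i, Real.negMulLog (μ.real (q.S i))) :=
  ENNReal.summable_of_tsum_ofReal_ne_top q.negMulLog_nonneg h

lemma distortion_le_iff (q : Quantizer (Fin d → ℝ)) (hN : IsNorm N)
    {D : ℝ} (hD : 0 ≤ D) (h : q.distortion μ N r ≤ ENNReal.ofReal D) :
    (∀ i, IntegrableOn (fun x => N (x - q.c i) ^ r) (q.S i) μ) ∧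
      Summable (fun i => ∫ x in q.S i, N (x - q.c i) ^ r ∂μ) ∧
      ∑' i, ∫ x in q.S i, N (x - q.c i) ^ r ∂μ ≤ D := by
  have hm := hN.measurable
  have h0 : ∀ i, 0 ≤ ∫ x in q.S i, N (x - q.c i) ^ r ∂μ := fun i =>
    integral_nonneg fun x => hN.rpow_nonneg r _
  have htop : q.distortion μ N r ≠ ∞ := (h.trans_lt ENNReal.ofReal_lt_top).ne
  have hint : ∀ i, IntegrableOn (fun x => N (x - q.c i) ^ r) (q.S i) μ := fun i => by
    refine ⟨Measurable.aestronglyMeasurable (by fun_prop), ?_⟩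
    rw [hasFiniteIntegral_iff_ofReal (Eventually.of_forall fun x => hN.rpow_nonneg r _)]
    exact (ENNReal.ne_top_of_tsum_ne_top htop i).lt_top
  have heq : q.distortion μ N r =
      ∑' i, ENNReal.ofReal (∫ x in q.S i, N (x - q.c i) ^ r ∂μ) :=
    tsum_congr fun i => (ofReal_integral_eq_lintegral_ofReal (hint i)
      (Eventually.of_forall fun x => hN.rpow_nonneg r _)).symm
  rw [heq] at h htop
  obtain ⟨hs, hs'⟩ := ENNReal.summable_of_tsum_ofReal_ne_top h0 htop
  rw [hs', ENNReal.ofReal_le_ofReal_iff hD] at h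
  exact ⟨hint, hs, h⟩

lemma hasSum_setIntegral (q : Quantizer (Fin d → ℝ)) {Q : (Fin d → ℝ) → ℝ}
    (hQ : Integrable Q μ) : HasSum (fun i => ∫ x in q.S i, Q x ∂μ) (∫ x, Q x ∂μ) := by
  have := hasSum_integral_iUnion (μ := μ) q.meas q.disj hQ.integrableOn
  rwa [q.cover, setIntegral_univ] at this

lemma hasSum_measureReal_inter [IsProbabilityMeasure μ] (q : Quantizer (Fin d → ℝ))
    {E : Set (Fin d → ℝ)} (hE : MeasurableSet E) :
    HasSum (fun i => μ.real (q.S i ∩ E)) (μ.real E) := by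
  have h := q.hasSum_setIntegral (μ := μ) ((integrable_const (1 : ℝ)).indicator hE)
  simpa [integral_indicator hE, Measure.restrict_restrict hE, inter_comm E] using h

lemma hasSum_measureReal [IsProbabilityMeasure μ] (q : Quantizer (Fin d → ℝ)) :
    HasSum (fun i => μ.real (q.S i)) 1 := by
  simpa using q.hasSum_measureReal_inter (μ := μ) MeasurableSet.univ

end Quantizer

/-- Lower bound for the entropy of a quantizer in terms of its distortion. -/
lemma IsSource.le_entropy [IsProbabilityMeasure μ] (h : IsSource μ f) (hN : IsNorm N)
    (hd : 0 < d) (hr : 0 < r) {lam η ρ D : ℝ} {K : Set (Fin d → ℝ)} (hl : 1 ≤ lam) (hη : 0 < η)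
    (hη1 : η < 1) (hρ : 0 < ρ) (hD : 0 < D) (hDη : D ≤ η / 2 * (ρ / 2) ^ r)
    (hK : MeasurableSet K) (hKμ : μ.real Kᶜ ≤ η / 2) (hKf : ∀ x ∈ K, 0 < f x)
    (hosc : ∀ x ∈ K, ∀ y ∈ K, N (x - y) < ρ → f x ≤ lam * f y)
    (q : Quantizer (Fin d → ℝ)) (hq : q.distortion μ N r ≤ ENNReal.ofReal D) :
    ENNReal.ofReal (-∫ x, Real.log (f x) ∂μ + d / r * Real.log (d / (r * D)) +
      d / r * Real.log (r / (d + r)) - Real.log (IsNorm.ballVol N) -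
      (η * |-Real.log (Real.Gamma (1 + d / r)) - d / r * (1 + Real.log (r / (d + r)))| -
        Real.log (1 - η) + Real.negMulLog η + 2 * Real.log lam)) ≤ q.entropy μ := by
  by_cases htop : q.entropy μ = ∞
  · rw [htop]
    exact le_top
  obtain ⟨hHs, hHe⟩ := q.summable_negMulLog htop
  rw [hHe]
  refine ENNReal.ofReal_le_ofReal ?_
  obtain ⟨hgi, hDs, hDle⟩ := q.distortion_le_iff hN hD.le hq
  have hd' : (0 : ℝ) < d := by exact_mod_cast hd
  have hNm := hN.measurable
  have hV := hN.ballVol_pos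
  have hΓ := IsNorm.gamma_pos d hr
  set s := d / (r * D) with hs
  have hs0 : 0 < s := by positivity
  set Z := IsNorm.ballVol N * Real.Gamma (1 + d / r) * s ^ (-(d / r) : ℝ) with hZ
  have hZ0 : 0 < Z := by positivity
  set G : ℤ → Set (Fin d → ℝ) := fun i => K ∩ {x | N (x - q.c i) < ρ / 2} with hG
  have hGm : ∀ i, MeasurableSet (G i) := fun i =>
    hK.inter (measurableSet_lt (by fun_prop) (by fun_prop))
  set a : ℤ → ℝ := fun i => μ.real (q.S i ∩ G i) with ha
  set b : ℤ → ℝ := fun i => μ.real (q.S i \ G i) with hb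
  have hab : ∀ i, a i + b i = μ.real (q.S i) := fun i => measureReal_inter_add_sdiff (hGm i)
  have ha0 : ∀ i, 0 ≤ a i := fun i => measureReal_nonneg
  have hb0 : ∀ i, 0 ≤ b i := fun i => measureReal_nonneg
  have hp := q.hasSum_measureReal (μ := μ)
  have has : Summable a := hp.summable.of_nonneg_of_le ha0 fun i => by linarith [hab i, hb0 i]
  have hbs : Summable b := hp.summable.of_nonneg_of_le hb0 fun i => by linarith [hab i, ha0 i]
  have hab1 : ∑' i, a i + ∑' i, b i = 1 := by
    rw [← has.tsum_add hbs, ← hp.tsum_eq]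
    exact tsum_congr hab
  have hρr : 0 < (ρ / 2) ^ r := by positivity
  have hbη : ∑' i, b i ≤ η := by
    have hKs := q.hasSum_measureReal_inter (μ := μ) hK.compl
    have hle : ∀ i, b i ≤ μ.real (q.S i ∩ Kᶜ) +
        ((ρ / 2) ^ r)⁻¹ * ∫ x in q.S i, N (x - q.c i) ^ r ∂μ := fun i => by
      have hsub : q.S i \ G i ⊆
          (q.S i ∩ Kᶜ) ∪ ({x | (ρ / 2) ^ r ≤ N (x - q.c i) ^ r} ∩ q.S i) := by
        rintro x ⟨hx1, hx2⟩
        by_cases hxK : x ∈ K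
        · refine Or.inr ⟨?_, hx1⟩
          have h3 : ρ / 2 ≤ N (x - q.c i) := by simpa [hG, hxK] using hx2
          have h4 : (ρ / 2) ^ r ≤ N (x - q.c i) ^ r := by gcongr
          simpa using h4
        · exact Or.inl ⟨hx1, hxK⟩
      have h1 := (measureReal_mono (μ := μ) hsub).trans (measureReal_union_le _ _)
      have h2 := mul_meas_ge_le_integral_of_nonneg (μ := μ.restrict (q.S i))
        (Eventually.of_forall fun x => hN.rpow_nonneg r (x - q.c i)) (hgi i) ((ρ / 2) ^ r)
      rw [measureReal_restrict_apply (measurableSet_le (by fun_prop) (by fun_prop)),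
        ← le_inv_mul_iff₀ hρr] at h2
      linarith
    have h1 := hbs.tsum_le_tsum hle (hKs.summable.add (hDs.mul_left _))
    rw [hKs.summable.tsum_add (hDs.mul_left _), hKs.tsum_eq, tsum_mul_left] at h1
    have h2 : ((ρ / 2) ^ r)⁻¹ * ∑' i, ∫ x in q.S i, N (x - q.c i) ^ r ∂μ ≤ η / 2 := by
      rw [inv_mul_le_iff₀ hρr]
      linarith
    linarith
  set cA := d / r * (1 + Real.log (s * r / (d + r))) - Real.log (IsNorm.ballVol N) -
    2 * Real.log lam with hcA
  have hterm : ∀ i, a i * (cA + Real.log (1 - η)) + b i * (-Real.log Z + Real.log η) ≤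
      Real.negMulLog (μ.real (q.S i)) + ∫ x in q.S i, Real.log (f x) ∂μ +
        s * ∫ x in q.S i, N (x - q.c i) ^ r ∂μ := fun i => by
    have hA := h.le_of_oscillation hN hd hr ((q.meas i).inter (hGm i)) (q.c i)
      ((hgi i).mono_set inter_subset_left) hl hs0
      (fun x hx => hKf x hx.2.1) fun x hx y hy => by
        refine hosc x hx.2.1 y hy.2.1 ?_
        have h1 : N (x - q.c i) < ρ / 2 := by simpa using hx.2.2
        have h2 : N (y - q.c i) < ρ / 2 := by simpa using hy.2.2
        have h3 := hN.triangle (x - q.c i) (q.c i - y)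
        rw [sub_add_sub_cancel, hN.sub_comm (q.c i) y] at h3
        linarith
    have hi : Integrable fun x => Real.exp (-(s * N (x - q.c i) ^ r)) :=
      (hN.integrable_exp_mul hr hs0).comp_sub_right (q.c i)
    have hB := h.gibbs ((q.meas i).diff (hGm i))
      (((hgi i).mono_set sdiff_subset).const_mul s) hZ0 hi (by
        rw [integral_sub_right_eq_self (fun x => Real.exp (-(s * N x ^ r))) (q.c i),
          hN.integral_exp_mul hr hs0])
    rw [integral_const_mul] at hB
    have h1 := le_negMulLog_add (ha0 i) (hb0 i) hη hη1
    rw [hab i] at h1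
    have h2 := integral_inter_add_sdiff (μ := μ) (s := q.S i) (hGm i)
      h.integrable_log.integrableOn
    have h3 := integral_inter_add_sdiff (μ := μ) (s := q.S i) (hGm i) (hgi i)
    rw [← h2, ← h3]
    linarith
  have hLs := q.hasSum_setIntegral h.integrable_log
  have hsum := (((has.mul_right (cA + Real.log (1 - η))).add
    (hbs.mul_right (-Real.log Z + Real.log η))).tsum_le_tsum hterm
    ((hHs.add hLs.summable).add (hDs.mul_left s)))
  rw [(has.mul_right _).tsum_add (hbs.mul_right _), tsum_mul_right, tsum_mul_right,
    (hHs.add hLs.summable).tsum_add (hDs.mul_left s), hHs.tsum_add hLs.summable, hLs.tsum_eq,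
    tsum_mul_left] at hsum
  have hsD : s * ∑' i, ∫ x in q.S i, N (x - q.c i) ^ r ∂μ ≤ d / r := by
    have h1 : s * D = d / r := by rw [hs]; field_simp
    rw [← h1]
    gcongr
  have hb1 : 0 ≤ ∑' i, b i := tsum_nonneg hb0
  set β := ∑' i, b i with hβ
  have haβ : ∑' i, a i = 1 - β := by linarith
  have hlogZ : -Real.log Z = -Real.log (IsNorm.ballVol N) - Real.log (Real.Gamma (1 + d / r)) +
      d / r * Real.log s := by
    rw [hZ, Real.log_mul (by positivity) (by positivity), Real.log_mul hV.ne' hΓ.ne',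
      Real.log_rpow hs0]
    ring
  have hlogs : Real.log (s * r / (d + r)) = Real.log s + Real.log (r / (d + r)) := by
    rw [mul_div_assoc, Real.log_mul hs0.ne' (by positivity)]
  set k := -Real.log (Real.Gamma (1 + d / r)) - d / r * (1 + Real.log (r / (d + r))) with hk
  have hcB : -Real.log Z = cA + k + 2 * Real.log lam := by
    rw [hlogZ, hcA, hlogs, hk]
    ring
  have hlam : 0 ≤ Real.log lam := Real.log_nonneg hl
  have hη2 : Real.log (1 - η) ≤ 0 := Real.log_nonpos (by linarith) (by linarith)
  have hη3 : Real.log η ≤ 0 := Real.log_nonpos hη.le hη1.le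
  rw [haβ, hcB] at hsum
  have e1 : η * Real.log η ≤ β * Real.log η := mul_le_mul_of_nonpos_right hbη hη3
  have e2 : -(η * |k|) ≤ β * k := by
    have h1 := mul_le_mul_of_nonneg_right hbη (abs_nonneg k)
    have h2 := mul_le_mul_of_nonneg_left (neg_abs_le k) hb1
    linarith
  have e3 : 0 ≤ β * (2 * Real.log lam) := by positivity
  have e4 : β * Real.log (1 - η) ≤ 0 := mul_nonpos_of_nonneg_of_nonpos hb1 hη2
  have e5 : cA = d / r + d / r * Real.log s + d / r * Real.log (r / (d + r)) -
      Real.log (IsNorm.ballVol N) - 2 * Real.log lam := by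
    rw [hcA, hlogs]
    ring
  simp only [Real.negMulLog] at hsum ⊢
  linarith

lemma IsSource.eventually_le_RQfun [IsProbabilityMeasure μ] (h : IsSource μ f) (hN : IsNorm N)
    (hd : 0 < d) (hr : 0 < r) {ε : ℝ} (hε : 0 < ε) :
    ∀ᶠ D in 𝓝[>] (0 : ℝ), ENNReal.ofReal
      (-∫ x, Real.log (f x) ∂μ + d / r * Real.log (d / (r * D)) +
        d / r * Real.log (r / (d + r)) - Real.log (IsNorm.ballVol N) - ε) ≤ RQfun μ N r D := by
  set k := |-Real.log (Real.Gamma (1 + d / r)) - d / r * (1 + Real.log (r / (d + r)))| with hk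
  obtain ⟨η, hη0, hη1, hηε⟩ : ∃ η : ℝ, 0 < η ∧ η < 1 ∧
      η * k - Real.log (1 - η) + Real.negMulLog η ≤ ε / 2 := by
    have hc : Tendsto (fun η : ℝ => η * k - Real.log (1 - η) + Real.negMulLog η) (𝓝 0) (𝓝 0) := by
      have h1 : ContinuousAt (fun η : ℝ => η * k - Real.log (1 - η) + Real.negMulLog η) 0 := by
        refine ContinuousAt.add (ContinuousAt.sub (by fun_prop) ?_)
          Real.continuous_negMulLog.continuousAt
        exact ContinuousAt.log (by fun_prop) (by norm_num)
      simpa [ContinuousAt] using h1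
    have hev := (hc.mono_left nhdsWithin_le_nhds).eventually
      (Iic_mem_nhds (half_pos hε)) |>.and (Ioo_mem_nhdsGT one_pos)
    obtain ⟨η, h1, h2⟩ := hev.exists
    exact ⟨η, h2.1, h2.2, by simpa using h1⟩
  obtain ⟨K, ρ, hK, hρ, hKμ, hKf, hosc⟩ := h.exists_oscillation_le hN
    (Real.one_lt_exp_iff.2 (show 0 < ε / 4 by positivity)) (half_pos hη0)
  filter_upwards [Ioc_mem_nhdsGT (show 0 < η / 2 * (ρ / 2) ^ r by positivity)] with D hD
  refine le_iInf₂ fun q hq => (ENNReal.ofReal_le_ofReal ?_).trans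
    (h.le_entropy hN hd hr (Real.one_le_exp (by positivity)) hη0 hη1 hρ hD.1 hD.2 hK hKμ hKf
      hosc q hq)
  rw [Real.log_exp]
  linarith

end QuantizerLowerBound

section ShannonLowerBound

variable {d : ℕ} {N : (Fin d → ℝ) → ℝ} {r : ℝ} {μ : Measure (Fin d → ℝ)} {f : (Fin d → ℝ) → ℝ}

lemma lintegral_div_rnDeriv_le {α : Type*} [MeasurableSpace α] {π P : Measure α}
    [IsFiniteMeasure π] [SigmaFinite P] (hπ : π ≪ P) {U : α → ℝ} (hU : Measurable U) :
    ∫⁻ x, ENNReal.ofReal (U x / (π.rnDeriv P x).toReal) ∂π ≤ ∫⁻ x, ENNReal.ofReal (U x) ∂P := by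
  have hm := Measure.measurable_rnDeriv π P
  rw [← lintegral_rnDeriv_mul hπ (by fun_prop)]
  refine lintegral_mono fun x => ?_
  by_cases h0 : π.rnDeriv P x = 0
  · simp [h0]
  by_cases ht : π.rnDeriv P x = ∞
  · simp [ht]
  have hpos := ENNReal.toReal_pos h0 ht
  conv_lhs => rw [← ENNReal.ofReal_toReal ht]
  rw [← ENNReal.ofReal_mul hpos.le]
  refine ENNReal.ofReal_le_ofReal (le_of_eq ?_)
  rw [ENNReal.toReal_ofReal hpos.le]
  field_simp

/-- Gibbs' variational lower bound for the Kullback-Leibler divergence. -/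
lemma le_klDiv_of_lintegral_le_one {α : Type*} [MeasurableSpace α] {π P : Measure α}
    [IsProbabilityMeasure π] [SigmaFinite P] {U : α → ℝ} (hU : Measurable U)
    (hU0 : ∀ x, 0 ≤ U x) (hUpos : ∀ᵐ x ∂π, 0 < U x)
    (hU1 : ∫⁻ x, ENNReal.ofReal (U x) ∂P ≤ 1)
    (hlog : Integrable (fun x => Real.log (U x)) π) :
    ENNReal.ofReal (∫ x, Real.log (U x) ∂π) ≤ klDiv π P := by
  unfold klDiv
  split_ifs with hcond
  · obtain ⟨hπ, hint⟩ := hcond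
    refine ENNReal.ofReal_le_ofReal ?_
    have hm := Measure.measurable_rnDeriv π P
    set R : α → ℝ := fun x => U x / (π.rnDeriv P x).toReal with hR
    have hR0 : ∀ x, 0 ≤ R x := fun x => div_nonneg (hU0 x) ENNReal.toReal_nonneg
    have hR1 : ∫⁻ x, ENNReal.ofReal (R x) ∂π ≤ 1 := (lintegral_div_rnDeriv_le hπ hU).trans hU1
    have hRm : AEStronglyMeasurable R π := Measurable.aestronglyMeasurable (by fun_prop)
    have hRi : Integrable R π := by
      refine ⟨hRm, ?_⟩
      rw [hasFiniteIntegral_iff_ofReal (Eventually.of_forall hR0)]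
      exact hR1.trans_lt ENNReal.one_lt_top
    have hRint : ∫ x, R x ∂π ≤ 1 := by
      rw [integral_eq_lintegral_of_nonneg_ae (Eventually.of_forall hR0) hRm]
      exact ENNReal.toReal_le_of_le_ofReal zero_le_one (by simpa using hR1)
    have key : ∀ᵐ x ∂π, Real.log (U x) + 1 - R x ≤ Real.log (π.rnDeriv P x).toReal := by
      filter_upwards [hUpos, Measure.rnDeriv_pos hπ, hπ.ae_le (Measure.rnDeriv_ne_top π P)]
        with x h1 h2 h3
      have h4 := ENNReal.toReal_pos h2.ne' h3
      have h5 := Real.log_le_sub_one_of_pos (div_pos h1 h4)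
      rw [Real.log_div h1.ne' h4.ne'] at h5
      simp only [hR]
      linarith
    have h6 : ∫ x, (Real.log (U x) + 1 - R x) ∂π ≤ ∫ x, Real.log (π.rnDeriv P x).toReal ∂π :=
      integral_mono_ae ((hlog.add (integrable_const _)).sub hRi) hint key
    have h7 : ∫ x, (Real.log (U x) + 1 - R x) ∂π =
        (∫ x, (Real.log (U x) + 1) ∂π) - ∫ x, R x ∂π :=
      integral_sub (hlog.add (integrable_const _)) hRi
    rw [h7, integral_add hlog (integrable_const _)] at h6
    simp only [integral_const, probReal_univ, smul_eq_mul, one_mul] at h6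
    linarith
  · exact le_top

/-- The Shannon lower bound. -/
lemma IsSource.le_RDfun [IsProbabilityMeasure μ] (h : IsSource μ f) (hN : IsNorm N)
    (hd : 0 < d) (hr : 0 < r) {D : ℝ} (hD : 0 < D) :
    ENNReal.ofReal (-∫ x, Real.log (f x) ∂μ + d / r * Real.log (d / (r * D)) - d / r -
      Real.log (IsNorm.ballVol N * Real.Gamma (1 + d / r))) ≤ RDfun μ N r D := by
  have hd' : (0 : ℝ) < d := by exact_mod_cast hd
  have hV := hN.ballVol_pos
  have hΓ := IsNorm.gamma_pos d hr
  have hNm := hN.measurable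
  have hfm := h.measurable
  set s := d / (r * D) with hs
  have hs0 : 0 < s := by positivity
  set Z := IsNorm.ballVol N * Real.Gamma (1 + d / r) * s ^ (-(d / r) : ℝ) with hZ
  have hZ0 : 0 < Z := by positivity
  refine le_iInf fun κ => le_iInf fun hκ => le_iInf fun hdist => ?_
  set π := μ.compProd κ with hπ
  have hfst : π.map Prod.fst = μ := Measure.fst_compProd _ _
  have hsnd : IsProbabilityMeasure (π.map Prod.snd) :=
    Measure.isProbabilityMeasure_map (by fun_prop)
  set U : (Fin d → ℝ) × (Fin d → ℝ) → ℝ := fun p =>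
    Real.exp (-(s * N (p.1 - p.2) ^ r)) / (f p.1 * Z) with hU
  have hUm : Measurable U := by fun_prop
  have hU0 : ∀ p, 0 ≤ U p := fun p =>
    div_nonneg (Real.exp_pos _).le (mul_nonneg (h.nonneg _) hZ0.le)
  have hfπ : ∀ᵐ p ∂π, 0 < f p.1 := by
    refine ae_of_ae_map (f := Prod.fst) (p := fun x => 0 < f x) (by fun_prop) ?_
    rw [hfst]
    exact h.ae_pos
  have hUpos : ∀ᵐ p ∂π, 0 < U p := by
    filter_upwards [hfπ] with p hp
    exact div_pos (Real.exp_pos _) (mul_pos hp hZ0)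
  have hU1 : ∫⁻ p, ENNReal.ofReal (U p) ∂((π.map Prod.fst).prod (π.map Prod.snd)) ≤ 1 := by
    rw [hfst, lintegral_prod_symm' _ (by fun_prop)]
    have hinner : ∀ y, ∫⁻ x, ENNReal.ofReal (U (x, y)) ∂μ ≤ 1 := fun y => by
      have hi : Integrable fun x => Real.exp (-(s * N (x - y) ^ r)) / Z :=
        ((hN.integrable_exp_mul hr hs0).comp_sub_right y).div_const Z
      have h1 : ∫ x, Real.exp (-(s * N (x - y) ^ r)) / Z = 1 := by
        rw [integral_div, integral_sub_right_eq_self (fun x => Real.exp (-(s * N x ^ r))) y,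
          hN.integral_exp_mul hr hs0, div_self hZ0.ne']
      rw [h.eq, lintegral_withDensity_eq_lintegral_mul _ (by fun_prop) (by fun_prop)]
      calc ∫⁻ x, ((fun x => ENNReal.ofReal (f x)) * fun x => ENNReal.ofReal (U (x, y))) x
          ≤ ∫⁻ x, ENNReal.ofReal (Real.exp (-(s * N (x - y) ^ r)) / Z) := by
            refine lintegral_mono fun x => ?_
            simp only [Pi.mul_apply]
            rw [← ENNReal.ofReal_mul (h.nonneg x)]
            refine ENNReal.ofReal_le_ofReal ?_
            rcases (h.nonneg x).eq_or_lt with h0 | h0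
            · rw [← h0, zero_mul]
              positivity
            · simp only [hU]
              refine le_of_eq ?_
              field_simp
        _ = 1 := by
            rw [← ofReal_integral_eq_lintegral_ofReal hi
              (Eventually.of_forall fun x => by positivity), h1, ENNReal.ofReal_one]
    exact (lintegral_mono hinner).trans (by simp)
  have hg0 : ∀ p : (Fin d → ℝ) × (Fin d → ℝ), 0 ≤ N (p.1 - p.2) ^ r := fun p =>
    hN.rpow_nonneg r _
  have hgm : Measurable fun p : (Fin d → ℝ) × (Fin d → ℝ) => N (p.1 - p.2) ^ r := by fun_prop
  have hgi : Integrable (fun p : (Fin d → ℝ) × (Fin d → ℝ) => N (p.1 - p.2) ^ r) π := by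
    refine ⟨hgm.aestronglyMeasurable, ?_⟩
    rw [hasFiniteIntegral_iff_ofReal (Eventually.of_forall hg0)]
    exact hdist.trans_lt ENNReal.ofReal_lt_top
  have hgD : ∫ p, N (p.1 - p.2) ^ r ∂π ≤ D := by
    rw [integral_eq_lintegral_of_nonneg_ae (Eventually.of_forall hg0) hgm.aestronglyMeasurable]
    exact ENNReal.toReal_le_of_le_ofReal hD.le hdist
  have hlogf : Integrable (fun p : (Fin d → ℝ) × (Fin d → ℝ) => Real.log (f p.1)) π := by
    have h1 := h.integrable_log
    rw [← hfst, integrable_map_measure (Measurable.aestronglyMeasurable (by fun_prop))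
      (by fun_prop)] at h1
    exact h1
  have hlogf' : ∫ p, Real.log (f p.1) ∂π = ∫ x, Real.log (f x) ∂μ := by
    conv_rhs => rw [← hfst]
    rw [integral_map (by fun_prop) (Measurable.aestronglyMeasurable (by fun_prop))]
  have hlogU : (fun p => Real.log (U p)) =ᵐ[π] fun p =>
      -s * N (p.1 - p.2) ^ r - Real.log (f p.1) - Real.log Z := by
    filter_upwards [hfπ] with p hp
    simp only [hU]
    rw [Real.log_div (Real.exp_pos _).ne' (mul_pos hp hZ0).ne', Real.log_exp,
      Real.log_mul hp.ne' hZ0.ne']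
    ring
  have hint : Integrable (fun p : (Fin d → ℝ) × (Fin d → ℝ) =>
      -s * N (p.1 - p.2) ^ r - Real.log (f p.1) - Real.log Z) π :=
    ((hgi.const_mul _).sub hlogf).sub (integrable_const _)
  refine le_trans (ENNReal.ofReal_le_ofReal ?_) (le_klDiv_of_lintegral_le_one hUm hU0 hUpos hU1
    (hint.congr hlogU.symm))
  have h8 : ∫ p, (-s * N (p.1 - p.2) ^ r - Real.log (f p.1) - Real.log Z) ∂π =
      (∫ p, (-s * N (p.1 - p.2) ^ r - Real.log (f p.1)) ∂π) - ∫ p, Real.log Z ∂π :=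
    integral_sub ((hgi.const_mul _).sub hlogf) (integrable_const _)
  rw [integral_congr_ae hlogU, h8, integral_sub (hgi.const_mul _) hlogf, integral_const_mul, hlogf']
  simp only [integral_const, probReal_univ, smul_eq_mul, one_mul]
  have hlogZ : Real.log Z = Real.log (IsNorm.ballVol N * Real.Gamma (1 + d / r)) -
      d / r * Real.log s := by
    rw [hZ, Real.log_mul (by positivity) (by positivity), Real.log_rpow hs0]
    ring
  have hsD : s * D = d / r := by rw [hs]; field_simp
  have h9 := mul_le_mul_of_nonneg_left hgD hs0.le
  rw [hsD] at h9
  rw [hlogZ]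
  linarith

end ShannonLowerBound

section CubicQuantizer

variable {d : ℕ} {N : (Fin d → ℝ) → ℝ} {r : ℝ} {μ : Measure (Fin d → ℝ)} {f : (Fin d → ℝ) → ℝ}

/-- The quantizer whose regions are the half-open cubes of side `1 / n`. -/
def cubicQuantizer (e : ℤ ≃ (Fin d → ℤ)) (n : ℕ) : Quantizer (Fin d → ℝ) where
  S i := (fun x => floorVec ((n : ℝ) • x)) ⁻¹' {e i}
  c i := (n : ℝ)⁻¹ • latticePoint (e i)
  meas i := (measurable_floorVec.comp (measurable_const_smul _)) (measurableSet_singleton _)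
  disj i j hij := by
    refine Disjoint.preimage _ ?_
    simpa using fun h => hij (e.injective h)
  cover := by
    rw [eq_univ_iff_forall]
    intro x
    refine mem_iUnion.2 ⟨e.symm (floorVec ((n : ℝ) • x)), ?_⟩
    simp

lemma mem_cubicQuantizer {e : ℤ ≃ (Fin d → ℤ)} {n : ℕ} {i : ℤ} {x : Fin d → ℝ} :
    x ∈ (cubicQuantizer e n).S i ↔ floorVec ((n : ℝ) • x) = e i := by
  simp [cubicQuantizer]

lemma floorVec_le_of_smul_eq {n : ℕ} (hn : 0 < n) {x y : Fin d → ℝ}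
    (h : floorVec ((n : ℝ) • x) = floorVec ((n : ℝ) • y)) (j : Fin d) : ⌊x j⌋ ≤ ⌊y j⌋ := by
  have hn' : (0 : ℝ) < n := by exact_mod_cast hn
  have h1 : ⌊(n : ℝ) * x j⌋ = ⌊(n : ℝ) * y j⌋ := by simpa [floorVec] using congrFun h j
  have h2 : (n : ℤ) * ⌊x j⌋ ≤ ⌊(n : ℝ) * x j⌋ := by
    rw [Int.le_floor]
    push_cast
    gcongr
    exact Int.floor_le _
  rw [h1, Int.le_floor] at h2
  push_cast at h2
  rw [Int.le_floor]
  exact le_of_mul_le_mul_left h2 hn'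

lemma floorVec_eq_of_smul_eq {n : ℕ} (hn : 0 < n) {x y : Fin d → ℝ}
    (h : floorVec ((n : ℝ) • x) = floorVec ((n : ℝ) • y)) : floorVec x = floorVec y :=
  funext fun j => le_antisymm (floorVec_le_of_smul_eq hn h j) (floorVec_le_of_smul_eq hn h.symm j)

lemma volume_floorVec_preimage {n : ℕ} (hn : 0 < n) (k : Fin d → ℤ) :
    volume ((fun x : Fin d → ℝ => floorVec ((n : ℝ) • x)) ⁻¹' {k}) =
      ENNReal.ofReal ((n : ℝ)⁻¹ ^ d) := by
  have hn' : (0 : ℝ) < n := by exact_mod_cast hn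
  have h : (fun x : Fin d → ℝ => floorVec ((n : ℝ) • x)) ⁻¹' {k} =
      Set.pi univ fun j => Ico ((k j : ℝ) / n) (((k j : ℝ) + 1) / n) := by
    ext x
    simp only [mem_preimage, mem_singleton_iff, Set.mem_pi, mem_univ, true_imp_iff, mem_Ico,
      funext_iff, floorVec, Pi.smul_apply, smul_eq_mul, Int.floor_eq_iff, div_le_iff₀ hn',
      lt_div_iff₀ hn', mul_comm (x _)]
  rw [h, Real.volume_pi_Ico]
  have h1 : ∀ j, ((k j : ℝ) + 1) / n - (k j : ℝ) / n = (n : ℝ)⁻¹ := fun j => by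
    field_simp
    ring
  simp only [h1]
  rw [Finset.prod_const, Finset.card_univ, Fintype.card_fin, ENNReal.ofReal_pow (by positivity)]

lemma integral_floorProb [IsProbabilityMeasure μ] :
    Integrable (fun x : Fin d → ℝ => floorProb μ (floorVec x)) ∧
      ∫ x : Fin d → ℝ, floorProb μ (floorVec x) = 1 := by
  have hm : Measurable fun x : Fin d → ℝ => floorProb μ (floorVec x) :=
    (measurable_of_countable (floorProb μ)).comp measurable_floorVec
  have h0 : ∀ x : Fin d → ℝ, 0 ≤ floorProb μ (floorVec x) := fun x => floorProb_nonneg _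
  have hl : ∫⁻ x : Fin d → ℝ, ENNReal.ofReal (floorProb μ (floorVec x)) = 1 := by
    rw [← lintegral_map (f := fun k => ENNReal.ofReal (floorProb μ k)) (measurable_of_countable _)
      measurable_floorVec, lintegral_countable', ← tsum_ofReal_floorProb (μ := μ)]
    refine tsum_congr fun k => ?_
    have h1 := volume_floorVec_preimage one_pos k
    simp only [Nat.cast_one, one_smul, inv_one, one_pow, ENNReal.ofReal_one] at h1
    rw [Measure.map_apply measurable_floorVec (measurableSet_singleton k)]
    exact (congrArg (_ * ·) h1).trans (mul_one _)
  refine ⟨⟨hm.aestronglyMeasurable, ?_⟩, ?_⟩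
  · rw [hasFiniteIntegral_iff_ofReal (Eventually.of_forall h0), hl]
    exact ENNReal.one_lt_top
  · rw [integral_eq_lintegral_of_nonneg_ae (Eventually.of_forall h0) hm.aestronglyMeasurable, hl,
      ENNReal.toReal_one]

lemma cubicQuantizer_entropy_le [IsProbabilityMeasure μ]
    (hfloor : Summable fun k : Fin d → ℤ => Real.negMulLog (floorProb μ k))
    (e : ℤ ≃ (Fin d → ℤ)) {n : ℕ} (hn : 0 < n) :
    (cubicQuantizer e n).entropy μ ≤ ENNReal.ofReal
      (-∫ x, Real.log (floorProb μ (floorVec x)) ∂μ + d * Real.log n) := by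
  have hn' : (0 : ℝ) < n := by exact_mod_cast hn
  set q := cubicQuantizer e n with hq
  obtain ⟨hwi, hw1⟩ := integral_floorProb (μ := μ)
  have hli := integrable_log_floorProb hfloor
  set w : (Fin d → ℝ) → ℝ := fun x => floorProb μ (floorVec x) with hw
  set T : ℤ → ℝ := fun i => -(∫ x in q.S i, Real.log (w x) ∂μ) +
    μ.real (q.S i) * (d * Real.log n - 1) + ∫ x in q.S i, w x with hT
  have hTs : HasSum T (-∫ x, Real.log (w x) ∂μ + d * Real.log n) := by
    have h1 := (((q.hasSum_setIntegral hli).neg.add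
      ((q.hasSum_measureReal (μ := μ)).mul_right (d * Real.log n - 1))).add
      (q.hasSum_setIntegral hwi))
    rw [hw1] at h1
    have h2 : -∫ x, Real.log (w x) ∂μ + d * Real.log n =
        -(∫ x, Real.log (w x) ∂μ) + 1 * (d * Real.log n - 1) + 1 := by ring
    rw [h2]
    exact h1
  have hle : ∀ i, Real.negMulLog (μ.real (q.S i)) ≤ T i := fun i => by
    have hconst : ∀ x ∈ q.S i, ∀ y ∈ q.S i, w x = w y := fun x hx y hy => by
      rw [hq, mem_cubicQuantizer] at hx hy
      simp only [hw, floorVec_eq_of_smul_eq hn (hx.trans hy.symm)]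
    have hw0 : 0 ≤ ∫ x in q.S i, w x := integral_nonneg fun x => floorProb_nonneg _
    rcases (measureReal_nonneg : 0 ≤ μ.real (q.S i)).eq_or_lt with hp | hp
    · have h0 : μ.restrict (q.S i) = 0 := by
        rw [Measure.restrict_eq_zero]
        exact (measureReal_eq_zero_iff).1 hp.symm
      simpa [hT, h0, ← hp] using hw0
    · obtain ⟨x₀, hx₀, hx₀w⟩ : ∃ x ∈ q.S i, 0 < w x := by
        by_contra! hcon
        have h0 : μ (q.S i) = 0 := measure_mono_null
          (fun x hx => by simpa [w] using hcon x hx) (ae_iff.1 (ae_floorProb_pos (μ := μ)))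
        simp [measureReal_def, h0] at hp
      have h1 : ∫ x in q.S i, Real.log (w x) ∂μ = μ.real (q.S i) * Real.log (w x₀) := by
        rw [setIntegral_congr_fun (q.meas i) fun x hx => by rw [hconst x hx x₀ hx₀]]
        simp
      have hvol : volume.real (q.S i) = (n : ℝ)⁻¹ ^ d := by
        rw [measureReal_def, hq]
        simp only [cubicQuantizer]
        rw [volume_floorVec_preimage hn, ENNReal.toReal_ofReal (by positivity)]
      have h2 : ∫ x in q.S i, w x = (n : ℝ)⁻¹ ^ d * w x₀ := by
        rw [setIntegral_congr_fun (q.meas i) fun x hx => hconst x hx x₀ hx₀]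
        simp [hvol]
      have h3 := mul_log_add_sub_le hp.le (show 0 < (n : ℝ)⁻¹ ^ d * w x₀ by positivity)
      rw [Real.log_mul (by positivity) hx₀w.ne', Real.log_pow, Real.log_inv] at h3
      simp only [hT, h1, h2, Real.negMulLog]
      linarith
  have hT0 : ∀ i, 0 ≤ T i := fun i => (q.negMulLog_nonneg i).trans (hle i)
  rw [← hTs.tsum_eq, ENNReal.ofReal_tsum_of_nonneg hT0 hTs.summable]
  exact ENNReal.tsum_le_tsum fun i => ENNReal.ofReal_le_ofReal (hle i)

lemma cubicQuantizer_distortion_le [IsProbabilityMeasure μ] (hN : IsNorm N) (hr : 0 < r) {C : ℝ}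
    (hC : 0 < C) (hNC : ∀ x, N x ≤ C * ‖x‖) (e : ℤ ≃ (Fin d → ℤ)) {n : ℕ} (hn : 0 < n) :
    (cubicQuantizer e n).distortion μ N r ≤ ENNReal.ofReal ((C / n) ^ r) := by
  have hn' : (0 : ℝ) < n := by exact_mod_cast hn
  set q := cubicQuantizer e n with hq
  have hle : ∀ i, ∀ x ∈ q.S i, N (x - q.c i) ^ r ≤ (C / n) ^ r := fun i x hx => by
    rw [hq, mem_cubicQuantizer] at hx
    refine Real.rpow_le_rpow (hN.nonneg _) ((hNC _).trans ?_) hr.le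
    have h1 : x - q.c i = (n : ℝ)⁻¹ • ((n : ℝ) • x - latticePoint (floorVec ((n : ℝ) • x))) := by
      rw [smul_sub, inv_smul_smul₀ hn'.ne', hx]
      rfl
    have h2 : ‖(n : ℝ) • x - latticePoint (floorVec ((n : ℝ) • x))‖ ≤ 1 := by
      refine (pi_norm_le_iff_of_nonneg zero_le_one).2 fun j => ?_
      simp only [Pi.sub_apply, latticePoint, floorVec, Int.self_sub_floor]
      rw [Real.norm_of_nonneg (Int.fract_nonneg _)]
      exact (Int.fract_lt_one _).le
    rw [h1, norm_smul, Real.norm_of_nonneg (by positivity), div_eq_mul_inv]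
    gcongr
    exact mul_le_of_le_one_right (by positivity) h2
  calc q.distortion μ N r ≤ ∑' i, ENNReal.ofReal ((C / n) ^ r) * μ (q.S i) := by
        refine ENNReal.tsum_le_tsum fun i => ?_
        rw [← setLIntegral_const]
        exact setLIntegral_mono measurable_const fun x hx => ENNReal.ofReal_le_ofReal (hle i x hx)
    _ = ENNReal.ofReal ((C / n) ^ r) := by
        rw [ENNReal.tsum_mul_left, ← measure_iUnion q.disj q.meas, q.cover, measure_univ, mul_one]

lemma exists_RQfun_le [IsProbabilityMeasure μ] (hN : IsNorm N) (hd : 0 < d) (hr : 0 < r)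
    (hfloor : Summable fun k : Fin d → ℤ => Real.negMulLog (floorProb μ k)) :
    ∃ C, ∀ᶠ D in 𝓝[>] (0 : ℝ),
      RQfun μ N r D ≤ ENNReal.ofReal (C + d / r * Real.log (d / (r * D))) := by
  have hd' : (0 : ℝ) < d := by exact_mod_cast hd
  obtain ⟨C, hC, hNC⟩ := hN.exists_le_mul_norm
  have : Nonempty (Fin d) := ⟨⟨0, hd⟩⟩
  obtain ⟨e⟩ := nonempty_equiv_of_countable (α := ℤ) (β := Fin d → ℤ)
  refine ⟨-∫ x, Real.log (floorProb μ (floorVec x)) ∂μ + d * Real.log (2 * C) -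
    d / r * Real.log (d / r), ?_⟩
  filter_upwards [Ioc_mem_nhdsGT (show 0 < C ^ r by positivity)] with D hD
  have hD0 : 0 < D := hD.1
  set y := C / D ^ (1 / r) with hy
  have hDr : 0 < D ^ (1 / r) := by positivity
  have hy1 : 1 ≤ y := by
    rw [hy, one_le_div hDr]
    calc D ^ (1 / r) ≤ (C ^ r) ^ (1 / r) := by gcongr; exact hD.2
      _ = C := by rw [← Real.rpow_mul hC.le, mul_one_div_cancel hr.ne', Real.rpow_one]
  have hn : 0 < ⌈y⌉₊ := Nat.ceil_pos.2 (by linarith)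
  have hn' : (0 : ℝ) < ⌈y⌉₊ := by exact_mod_cast hn
  have hdist : (cubicQuantizer e ⌈y⌉₊).distortion μ N r ≤ ENNReal.ofReal D := by
    refine (cubicQuantizer_distortion_le hN hr hC hNC e hn).trans (ENNReal.ofReal_le_ofReal ?_)
    have h1 : C / ⌈y⌉₊ ≤ D ^ (1 / r) := by
      rw [div_le_iff₀ hn', mul_comm, ← div_le_iff₀ hDr]
      exact Nat.le_ceil y
    calc (C / ⌈y⌉₊) ^ r ≤ (D ^ (1 / r)) ^ r := by gcongr
      _ = D := by rw [← Real.rpow_mul hD0.le, one_div_mul_cancel hr.ne', Real.rpow_one]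
  refine (iInf₂_le (cubicQuantizer e ⌈y⌉₊) hdist).trans
    ((cubicQuantizer_entropy_le hfloor e hn).trans (ENNReal.ofReal_le_ofReal ?_))
  have h2 : Real.log ⌈y⌉₊ ≤ Real.log (2 * C) - 1 / r * Real.log D := by
    rw [← Real.log_rpow hD0, ← Real.log_div (by positivity) hDr.ne']
    refine Real.log_le_log hn' ?_
    have h3 := (Nat.ceil_lt_add_one (by linarith : 0 ≤ y)).le
    have h4 : 2 * C / D ^ (1 / r) = 2 * y := by rw [hy]; ring
    rw [h4]
    linarith
  have h5 : Real.log (d / (r * D)) = Real.log (d / r) - Real.log D := by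
    rw [← div_div, Real.log_div (by positivity) hD0.ne']
  have h6 := mul_le_mul_of_nonneg_left h2 hd'.le
  have h7 : d * (Real.log (2 * C) - 1 / r * Real.log D) =
      d * Real.log (2 * C) - d / r * Real.log D := by ring
  rw [h5]
  linarith

end CubicQuantizer

lemma tendsto_log_div_mul_atTop {a r : ℝ} (ha : 0 < a) (hr : 0 < r) :
    Tendsto (fun D => Real.log (a / (r * D))) (𝓝[>] 0) atTop := by
  have h : Tendsto (fun D : ℝ => a / r * D⁻¹) (𝓝[>] 0) atTop :=
    tendsto_inv_nhdsGT_zero.const_mul_atTop (by positivity)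
  refine Real.tendsto_log_atTop.comp (h.congr fun D => ?_)
  rw [← div_div, div_eq_mul_inv (a / r)]

lemma log_gamma_bound_eq {d r : ℝ} (hd : 0 < d) (hr : 0 < r) :
    d / r * Real.log (Real.Gamma (1 + d / r) ^ (r / d) * Real.exp 1 / (1 + d / r)) =
      Real.log (Real.Gamma (1 + d / r)) + d / r + d / r * Real.log (r / (d + r)) := by
  have hG : 0 < Real.Gamma (1 + d / r) := Real.Gamma_pos_of_pos (by positivity)
  have h1 : r / (d + r) = (1 + d / r)⁻¹ := by field_simp; ring
  rw [h1, Real.log_inv, Real.log_div (by positivity) (by positivity),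
    Real.log_mul (by positivity) (by positivity), Real.log_rpow hG, Real.log_exp]
  field_simp
  ring

theorem IsSource.le_excessRate {d : ℕ} {N : (Fin d → ℝ) → ℝ} {r : ℝ} {μ : Measure (Fin d → ℝ)}
    [IsProbabilityMeasure μ] {f : (Fin d → ℝ) → ℝ} (h : IsSource μ f) (hN : IsNorm N) (hd : 0 < d)
    (hr : 0 < r) (hfloor : Summable fun k : Fin d → ℤ => Real.negMulLog (floorProb μ k)) :
    Real.log (Real.Gamma (1 + d / r)) + d / r + d / r * Real.log (r / (d + r)) ≤
      excessRate μ N r := by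
  have hd' : (0 : ℝ) < d := by exact_mod_cast hd
  have hV := hN.ballVol_pos
  have hG : 0 < Real.Gamma (1 + d / r) := Real.Gamma_pos_of_pos (by positivity)
  have hVG := Real.log_mul hV.ne' hG.ne'
  have hlim := tendsto_log_div_mul_atTop hd' hr
  have hlarge : ∀ c : ℝ, ∀ᶠ D in 𝓝[>] (0 : ℝ), 0 ≤ c + d / r * Real.log (d / (r * D)) := fun c => by
    have h1 := tendsto_atTop_add_const_left _ c (hlim.const_mul_atTop (div_pos hd' hr))
    exact h1.eventually_ge_atTop 0
  obtain ⟨C, hC⟩ := exists_RQfun_le (μ := μ) hN hd hr hfloor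
  set A := -∫ x, Real.log (f x) ∂μ with hA
  set B := Real.log (IsNorm.ballVol N * Real.Gamma (1 + d / r)) with hB
  have hcob : IsCoboundedUnder (· ≥ ·) (𝓝[>] (0 : ℝ))
      fun D => (RQfun μ N r D).toReal - (RDfun μ N r D).toReal := by
    refine IsBoundedUnder.isCoboundedUnder_ge ⟨C - A + d / r + B, ?_⟩
    rw [eventually_map]
    filter_upwards [hC, h.eventually_RDfun_le hN hd hr hfloor one_pos, hlarge C,
      self_mem_nhdsWithin] with D hQ hR hC0 hD
    have h1 := ENNReal.toReal_le_of_le_ofReal hC0 hQ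
    have h2 := (ENNReal.ofReal_le_iff_le_toReal (hR.trans_lt ENNReal.ofReal_lt_top).ne).1
      (h.le_RDfun hN hd hr hD)
    linarith
  refine le_of_forall_pos_sub_le fun ε hε => ?_
  refine le_liminf_of_le hcob ?_
  filter_upwards [hC, h.eventually_RDfun_le hN hd hr hfloor (half_pos hε),
    h.eventually_le_RQfun hN hd hr (half_pos hε), hlarge (A - d / r - B + ε / 2)]
    with D hQ hR hQ' hR0
  have h1 := (ENNReal.ofReal_le_iff_le_toReal (hQ.trans_lt ENNReal.ofReal_lt_top).ne).1 hQ'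
  have h2 := ENNReal.toReal_le_of_le_ofReal (by linarith) hR
  linarith

/-- Theorem 1, main result: lower bound on the excess rate
`ℛ_{r,d} ≥ (d/r) log( Γ(1+d/r)^{r/d} e / (1+d/r) )`. -/
theorem excessRate_lower_bound {d : ℕ} (hd : 0 < d) {r : ℝ} (hr : 0 < r)
    {N : (Fin d → ℝ) → ℝ} (hN : IsNorm N)
    (μ : Measure (Fin d → ℝ)) [IsProbabilityMeasure μ]
    (f : (Fin d → ℝ) → ℝ) (hfm : Measurable f) (hf0 : ∀ x, 0 ≤ f x)
    (hμf : μ = volume.withDensity fun x => ENNReal.ofReal (f x))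
    (hent : Integrable (fun x => f x * Real.log (f x)))
    (hfloor : Summable fun k : Fin d → ℤ =>
      Real.negMulLog (μ {x | ∀ j, ⌊x j⌋ = k j}).toReal) :
    ((d : ℝ) / r) * Real.log (Real.Gamma (1 + (d : ℝ) / r) ^ (r / (d : ℝ)) * Real.exp 1
        / (1 + (d : ℝ) / r))
      ≤ excessRate μ N r := by
  rw [log_gamma_bound_eq (by exact_mod_cast hd) hr]
  exact IsSource.le_excessRate ⟨hfm, hf0, hμf, hent⟩ hN hd hr hfloor

end
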